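/- For any partitions π, μ and ν, the structure coefficient g^π_{μ,ν}(α) of Jack characters is a polynomial in b := α−1 with integer coefficients. -/

import Mathlib

open scoped Classical

noncomputable section

/-- The base field `ℚ(α)` of rational functions in the Jack parameter `α`. -/
abbrev F : Type := RatFunc ℚ

/-- The Jack deformation parameter `α`. -/
def alpha : F := RatFunc.X

/-- An integer partition, encoded as a multiset of positive integers (its parts). -/
abbrev JPartition : Type := Multiset ℕ+

/-- The size `|λ|` of a partition. -/
def psize (l : JPartition) : ℕ := (l.map fun i => (i : ℕ)).sum

/-- The length `ℓ(λ)` of a partition. -/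
def plen (l : JPartition) : ℕ := Multiset.card l

/-- `m_i(λ)`, the number of parts of `λ` equal to `i`. -/
def pmult (l : JPartition) (i : ℕ+) : ℕ := Multiset.count i l

/-- `λ ∪ 1^k`, adjoining `k` parts equal to `1`. -/
def addOnes (l : JPartition) (k : ℕ) : JPartition := l + Multiset.replicate k 1

/-- `λ̃`, the partition obtained by deleting all parts equal to `1`. -/
def removeOnes (l : JPartition) : JPartition := Multiset.filter (fun i => i ≠ 1) l

/-- Exponent vectors of monomials in the power-sum generators `p₁, p₂, …`. -/
abbrev Exp : Type := ℕ+ →₀ ℕ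

/-- The exponent vector of the monomial `p_λ`. -/
def toExp (l : JPartition) : Exp := l.toFinset.sum fun i => Finsupp.single i (Multiset.count i l)

/-- The partition corresponding to an exponent vector. -/
def toPart (m : Exp) : JPartition := m.sum fun i k => Multiset.replicate k i

/-- The weighted degree (`deg p_i = i`) of an exponent vector; this is the size of the
corresponding partition. -/
def wt (m : Exp) : ℕ := m.sum fun i k => k * (i : ℕ)

/-- The algebra `ℚ(α)[p₁, p₂, …]` of symmetric functions written in the power-sum basis. -/
abbrev SymA : Type := MvPolynomial ℕ+ F

/-- The power-sum monomial `p_λ`. -/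
def pPow (l : JPartition) : SymA := (l.map fun i => MvPolynomial.X i).prod

/-- `z_λ α^{ℓ(λ)}`, attached to the exponent vector of `p_λ`. -/
def zalpha (m : Exp) : F :=
  algebraMap ℚ F (m.prod fun i k => (Nat.factorial k : ℚ) * ((i : ℕ) : ℚ) ^ k) *
    alpha ^ (m.sum fun _ k => k)

/-- The `α`-deformed Hall scalar product: `⟨p_λ, p_μ⟩ = δ_{λμ} z_λ α^{ℓ(λ)}`. -/
def hall (f g : SymA) : F :=
  ∑ m ∈ f.support, MvPolynomial.coeff m f * MvPolynomial.coeff m g * zalpha m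

/-- The parts of a partition, sorted in weakly decreasing order. -/
def sortedParts (l : JPartition) : List ℕ := ((l.map fun i => (i : ℕ)).sort (· ≤ ·)).reverse

/-- The sum of the `k` largest parts of a partition. -/
def topSum (l : JPartition) (k : ℕ) : ℕ := ((sortedParts l).take k).sum

/-- The dominance order on partitions: `μ ⊴ λ`. -/
def dominates (mu lam : JPartition) : Prop :=
  psize mu = psize lam ∧ ∀ k, topSum mu k ≤ topSum lam k

/-- Evaluation of a symmetric function (in power-sum coordinates) in `N` variables
`x₁, …, x_N`: it sends `p_i ↦ x₁^i + ⋯ + x_N^i`. -/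
def evalN (N : ℕ) : SymA →ₐ[F] MvPolynomial (Fin N) F :=
  MvPolynomial.aeval fun i : ℕ+ => ∑ j : Fin N, MvPolynomial.X j ^ (i : ℕ)

/-- The exponent of the monomial `x₁^{μ₁} ⋯ x_s^{μ_s}` in `N` variables, for `μ` a
partition; its coefficient in a symmetric polynomial is the coefficient of the monomial
symmetric function `m_μ` (provided `N ≥ ℓ(μ)`). -/
def xexp (mu : JPartition) (N : ℕ) : Fin N →₀ ℕ :=
  Finsupp.equivFunOnFinite.symm fun j => (sortedParts mu).getD (j : ℕ) 0

/-- The defining properties of the family of Jack polynomials `J_λ^{(α)}` (Macdonald's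
characterization): orthogonality for the `α`-deformed Hall product, triangularity with
respect to monomial symmetric functions in dominance order, and normalization
`[p_{1^n}] J_λ^{(α)} = 1`. -/
structure IsJackFamily (J : JPartition → SymA) : Prop where
  orthogonal : ∀ l m : JPartition, l ≠ m → hall (J l) (J m) = 0
  triangular : ∀ l m : JPartition, ¬ dominates m l →
    MvPolynomial.coeff (xexp m (psize l + psize m + plen m))
      (evalN (psize l + psize m + plen m) (J l)) = 0
  normalized : ∀ l : JPartition, MvPolynomial.coeff (Finsupp.single 1 (psize l)) (J l) = 1

/-- The Jack character `θ_μ^{(α)}(λ)`. -/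
def theta (J : JPartition → SymA) (mu lam : JPartition) : F :=
  if psize lam < psize mu then 0
  else (Nat.choose (psize lam - psize mu + pmult mu 1) (pmult mu 1) : F) *
    MvPolynomial.coeff (toExp (addOnes mu (psize lam - psize mu))) (J lam)

/-- `g` is the family of structure coefficients of Jack characters:
`θ_μ^{(α)} θ_ν^{(α)} = ∑_π g^π_{μ,ν}(α) θ_π^{(α)}` (as functions on Young diagrams,
with finitely many nonzero terms). -/
def IsStructCoeffs (J : JPartition → SymA) (g : JPartition → JPartition → JPartition → F) :
    Prop :=
  (∀ mu nu : JPartition, {pi : JPartition | g pi mu nu ≠ 0}.Finite) ∧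
  ∀ mu nu lam : JPartition,
    theta J mu lam * theta J nu lam = ∑ᶠ pi : JPartition, g pi mu nu * theta J pi lam



open MvPolynomial

/-! ### The integral ring and weights -/

def ZA : Subring F := (Polynomial.eval₂RingHom (Int.castRingHom F) (alpha - 1)).range

theorem alpha_mem_ZA : alpha ∈ ZA := by
  refine ⟨Polynomial.X + 1, ?_⟩
  simp

theorem alpha_ne_zero : alpha ≠ 0 := RatFunc.X_ne_zero

theorem wt_add (m m' : Exp) : wt (m + m') = wt m + wt m' := by
  unfold wt
  rw [Finsupp.sum_add_index']
  · intro i; simp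
  · intro i a b; ring

@[simp] theorem wt_single (k : ℕ+) (a : ℕ) : wt (Finsupp.single k a) = a * k := by
  unfold wt
  rw [Finsupp.sum_single_index]; simp

@[simp] theorem wt_zero : wt 0 = 0 := by simp [wt]

theorem zalpha_ne_zero (m : Exp) : zalpha m ≠ 0 := by
  unfold zalpha
  refine mul_ne_zero ?_ (pow_ne_zero _ alpha_ne_zero)
  rw [Ne, map_eq_zero]
  refine Finset.prod_ne_zero_iff.2 ?_
  intro i _
  positivity

theorem zalpha_add_single (m : Exp) (k : ℕ+) :
    zalpha (m + Finsupp.single k 1) = zalpha m * (alpha * ((k : ℕ) : F) * ((m k : F) + 1)) := by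
  unfold zalpha
  have h1 : ((m + Finsupp.single k 1).sum fun _ k => k) = (m.sum fun _ k => k) + 1 := by
    rw [Finsupp.sum_add_index' (by simp) (by simp)]
    simp
  have h2 : ((m + Finsupp.single k 1).prod fun i k => (Nat.factorial k : ℚ) * ((i : ℕ) : ℚ) ^ k)
      = (m.prod fun i k => (Nat.factorial k : ℚ) * ((i : ℕ) : ℚ) ^ k) * (((k : ℕ) : ℚ) * (m k + 1)) := by
    rw [Finsupp.prod_of_support_subset (s := insert k m.support) _ _ _ (by simp),
      Finsupp.prod_of_support_subset (s := insert k m.support) m _ _ (by simp)]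
    · rw [← Finset.mul_prod_erase (insert k m.support) _ (Finset.mem_insert_self k _),
        ← Finset.mul_prod_erase (insert k m.support)
          (fun i => ((m i).factorial : ℚ) * ((i : ℕ) : ℚ) ^ (m i)) (Finset.mem_insert_self k _)]
      have : ∀ i ∈ (insert k m.support).erase k,
          (((m + Finsupp.single k 1 : Exp) i).factorial : ℚ) * ((i : ℕ) : ℚ) ^ ((m + Finsupp.single k 1 : Exp) i)
          = ((m i).factorial : ℚ) * ((i : ℕ) : ℚ) ^ (m i) := by
        intro i hi
        have : i ≠ k := Finset.ne_of_mem_erase hi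
        have h3 : (m + Finsupp.single k 1 : Exp) i = m i := by simp [Finsupp.single_apply, this.symm]
        rw [h3]
      rw [Finset.prod_congr rfl this]
      have h3 : (m + Finsupp.single k 1 : Exp) k = m k + 1 := by simp
      rw [h3, Nat.factorial_succ]
      push_cast
      ring
    · simp
    · intro i hi
      simp only [Finsupp.mem_support_iff, Finsupp.add_apply, Finset.mem_insert] at hi ⊢
      by_contra hc
      push Not at hc
      apply hi
      simp [hc.2, Finsupp.single_apply, hc.1.symm]
  rw [h1, h2, map_mul, map_mul, pow_succ]
  simp only [map_natCast, map_add, map_one]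
  ring

@[simp] theorem zalpha_zero : zalpha 0 = 1 := by simp [zalpha]

/-- Weighted-homogeneous part -/
def Lam (n : ℕ) : Submodule F SymA where
  carrier := {f | ∀ m, wt m ≠ n → coeff m f = 0}
  add_mem' := by
    intro f g hf hg m hm
    rw [coeff_add, hf m hm, hg m hm, add_zero]
  zero_mem' := by intro m _; simp
  smul_mem' := by
    intro c f hf m hm
    rw [coeff_smul, hf m hm, smul_zero]

theorem mem_Lam {n : ℕ} {f : SymA} : f ∈ Lam n ↔ ∀ m, wt m ≠ n → coeff m f = 0 := Iff.rfl

theorem monomial_mem_Lam (m : Exp) (c : F) : monomial m c ∈ Lam (wt m) := by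
  intro m' h
  rw [coeff_monomial, if_neg]
  rintro rfl; exact h rfl

theorem monomial_mem_Lam' {n : ℕ} (m : Exp) (c : F) (h : wt m = n) : monomial m c ∈ Lam n := by
  subst h; exact monomial_mem_Lam m c

theorem X_mem_Lam (k : ℕ+) : (X k : SymA) ∈ Lam k := 
  monomial_mem_Lam' _ _ (by simp)

theorem X_mul_mem_Lam {n : ℕ} {f : SymA} (k : ℕ+) (hf : f ∈ Lam n) : X k * f ∈ Lam (k + n) := by
  intro m hm
  rw [coeff_X_mul']
  split_ifs with h
  · apply hf
    intro hc
    apply hm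
    have : m = Finsupp.single k 1 + (m - Finsupp.single k 1) := by
      ext i
      rcases eq_or_ne k i with rfl | hi
      · have : m k ≠ 0 := by simpa using h
        simp; omega
      · simp [Finsupp.single_apply, hi]
    rw [this, wt_add, hc]; simp
  · rfl

/-- adjoint of multiplication by `p_k` -/
def perp (k : ℕ+) : SymA →ₗ[F] SymA := (alpha * ((k : ℕ) : F)) • (pderiv k).toLinearMap

theorem perp_apply (k : ℕ+) (f : SymA) : perp k f = (alpha * ((k : ℕ) : F)) • pderiv k f := rfl

theorem coeff_perp (k : ℕ+) (f : SymA) (m : Exp) :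
    coeff m (perp k f) = alpha * ((k : ℕ) : F) * ((m k : F) + 1) * coeff (m + Finsupp.single k 1) f := by
  rw [perp_apply, coeff_smul, coeff_pderiv, smul_eq_mul]; ring

theorem perp_mem_Lam {n d : ℕ} {f : SymA} (k : ℕ+) (hf : f ∈ Lam n) (h : d + k = n) :
    perp k f ∈ Lam d := by
  intro m hm
  rw [coeff_perp, hf, mul_zero]
  rw [wt_add, wt_single, one_mul]
  omega

theorem perp_eq_zero {n : ℕ} {f : SymA} (k : ℕ+) (hf : f ∈ Lam n) (h : n < k) :
    perp k f = 0 := by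
  ext m
  rw [coeff_perp, hf, mul_zero, coeff_zero]
  rw [wt_add, wt_single, one_mul]
  omega

/-- twisted coefficients -/
def tc (m : Exp) (f : SymA) : F := coeff m f * zalpha m

theorem tc_perp (m : Exp) (k : ℕ+) (f : SymA) : tc m (perp k f) = tc (m + Finsupp.single k 1) f := by
  rw [tc, tc, coeff_perp, zalpha_add_single]; ring

/-! ### Hall product -/

theorem hall_eq_sum (f g : SymA) (s : Finset Exp) (hs : f.support ⊆ s) :
    hall f g = ∑ m ∈ s, coeff m f * coeff m g * zalpha m := by
  unfold hall
  refine Finset.sum_subset hs ?_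
  intro m _ hm
  rw [notMem_support_iff.1 hm]; ring

theorem hall_symm (f g : SymA) : hall f g = hall g f := by
  rw [hall_eq_sum f g (f.support ∪ g.support) Finset.subset_union_left,
    hall_eq_sum g f (f.support ∪ g.support) Finset.subset_union_right]
  refine Finset.sum_congr rfl fun m _ => ?_
  ring

def hallR (f : SymA) : SymA →ₗ[F] F where
  toFun g := hall f g
  map_add' a b := by
    unfold hall
    rw [← Finset.sum_add_distrib]
    refine Finset.sum_congr rfl fun m _ => ?_
    rw [coeff_add]; ring
  map_smul' c a := by
    unfold hall
    rw [RingHom.id_apply, smul_eq_mul, Finset.mul_sum]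
    refine Finset.sum_congr rfl fun m _ => ?_
    rw [coeff_smul, smul_eq_mul]; ring

theorem hallR_apply (f g : SymA) : hallR f g = hall f g := rfl

theorem hall_add_right (f a b : SymA) : hall f (a + b) = hall f a + hall f b := map_add (hallR f) a b
theorem hall_smul_right (f : SymA) (c : F) (a : SymA) : hall f (c • a) = c * hall f a :=
  map_smul (hallR f) c a
theorem hall_zero_right (f : SymA) : hall f 0 = 0 := map_zero (hallR f)
theorem hall_sum_right {ι : Type*} (f : SymA) (s : Finset ι) (a : ι → SymA) :
    hall f (∑ i ∈ s, a i) = ∑ i ∈ s, hall f (a i) := map_sum (hallR f) a s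
theorem hall_add_left (f a b : SymA) : hall (a + b) f = hall a f + hall b f := by
  rw [hall_symm, hall_add_right, hall_symm f, hall_symm f]
theorem hall_smul_left (f : SymA) (c : F) (a : SymA) : hall (c • a) f = c * hall a f := by
  rw [hall_symm, hall_smul_right, hall_symm f]
theorem hall_zero_left (f : SymA) : hall 0 f = 0 := by
  rw [hall_symm, hall_zero_right]
theorem hall_sum_left {ι : Type*} (f : SymA) (s : Finset ι) (a : ι → SymA) :
    hall (∑ i ∈ s, a i) f = ∑ i ∈ s, hall (a i) f := by
  rw [hall_symm, hall_sum_right]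
  exact Finset.sum_congr rfl fun i _ => hall_symm _ _

theorem hall_monomial_left (m : Exp) (c : F) (g : SymA) :
    hall (monomial m c) g = c * tc m g := by
  rw [hall_eq_sum _ _ {m} support_monomial_subset, Finset.sum_singleton, coeff_monomial, if_pos rfl, tc,
    mul_assoc]

theorem hall_X_mul (k : ℕ+) (f g : SymA) : hall (X k * f) g = hall f (perp k g) := by
  induction f using MvPolynomial.induction_on' with
  | monomial u a =>
    rw [X, monomial_mul, hall_monomial_left, hall_monomial_left, tc_perp, add_comm, one_mul]
  | add p q hp hq => rw [mul_add, hall_add_left, hall_add_left, hp, hq]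

theorem hall_mul_X (k : ℕ+) (f g : SymA) : hall f (X k * g) = hall (perp k f) g := by
  rw [hall_symm, hall_X_mul, hall_symm]

theorem hall_self_eq_zero {f : SymA} (h : hall f f = 0) : f = 0 := by
  -- common denominator
  obtain ⟨d, hd⟩ := IsLocalization.exist_integer_multiples_of_finset (nonZeroDivisors (Polynomial ℚ))
    (f.support.image fun m => coeff m f)
  have hd' : ∀ m, ∃ n : Polynomial ℚ, algebraMap (Polynomial ℚ) F n = algebraMap (Polynomial ℚ) F d * coeff m f := by
    intro m
    by_cases hm : m ∈ f.support
    · obtain ⟨n, hn⟩ := hd _ (Finset.mem_image_of_mem _ hm)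
      refine ⟨n, ?_⟩
      rw [hn, Algebra.smul_def]
    · exact ⟨0, by rw [notMem_support_iff.1 hm]; simp⟩
  choose n hn using hd'
  have hdne : algebraMap (Polynomial ℚ) F d ≠ 0 := by
    rw [Ne, FaithfulSMul.algebraMap_eq_zero_iff]
    exact nonZeroDivisors.ne_zero d.2
  let z : Exp → ℚ := fun m => m.prod fun i k => (Nat.factorial k : ℚ) * ((i : ℕ) : ℚ) ^ k
  let l : Exp → ℕ := fun m => m.sum fun _ k => k
  have key : ∑ m ∈ f.support, n m * n m * (Polynomial.C (z m) * Polynomial.X ^ (l m)) = 0 := by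
    apply FaithfulSMul.algebraMap_injective (Polynomial ℚ) F
    rw [map_sum, map_zero]
    have : ∀ m ∈ f.support, algebraMap (Polynomial ℚ) F (n m * n m * (Polynomial.C (z m) * Polynomial.X ^ (l m)))
       = (algebraMap (Polynomial ℚ) F d)^2 * (coeff m f * coeff m f * zalpha m) := by
      intro m _
      rw [map_mul, map_mul, hn, map_mul, map_pow]
      have h1 : algebraMap (Polynomial ℚ) F (Polynomial.C (z m)) = algebraMap ℚ F (z m) := by
        rw [RatFunc.algebraMap_C]; exact DFunLike.congr_fun (Subsingleton.elim (RatFunc.C) (algebraMap ℚ F)) (z m)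
      have h2 : algebraMap (Polynomial ℚ) F Polynomial.X = alpha := by
        rw [RatFunc.algebraMap_X]; rfl
      rw [h1, h2]
      unfold zalpha
      ring
    rw [Finset.sum_congr rfl this, ← Finset.mul_sum]
    unfold hall at h
    rw [h, mul_zero]
  have zpos : ∀ m, 0 < z m := by
    intro m
    refine Finset.prod_pos fun i _ => ?_
    positivity
  have hn0 : ∀ m ∈ f.support, n m = 0 := by
    intro m hm
    apply Polynomial.eq_zero_of_infinite_isRoot
    refine Set.Infinite.mono ?_ (Set.Ioi_infinite (0 : ℚ))
    intro t ht
    have ht : 0 < t := ht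
    have h1 := congrArg (Polynomial.eval t) key
    rw [Polynomial.eval_finsetSum, Polynomial.eval_zero,
      Finset.sum_eq_zero_iff_of_nonneg] at h1
    · have := h1 m hm
      simp only [Polynomial.eval_mul, Polynomial.eval_pow, Polynomial.eval_C, Polynomial.eval_X,
        mul_eq_zero, or_self, (zpos m).ne', pow_eq_zero_iff', ht.ne', false_and, or_false] at this
      exact this
    · intro i _
      simp only [Polynomial.eval_mul, Polynomial.eval_pow, Polynomial.eval_C, Polynomial.eval_X]
      have := zpos i
      have := mul_self_nonneg (Polynomial.eval t (n i))
      positivity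
  ext m
  by_cases hm : m ∈ f.support
  · have := hn m
    rw [hn0 m hm, map_zero, eq_comm, mul_eq_zero] at this
    simpa [hdne] using this
  · simpa using hm

/-! ### The lattice `Lq` -/

def Lq : AddSubgroup SymA where
  carrier := {f | ∀ m, tc m f ∈ ZA}
  add_mem' := by
    intro f g hf hg m
    rw [tc, coeff_add, add_mul]; exact ZA.add_mem (hf m) (hg m)
  zero_mem' := by intro m; rw [tc, coeff_zero, zero_mul]; exact ZA.zero_mem
  neg_mem' := by
    intro f hf m
    rw [tc, coeff_neg, neg_mul]; exact ZA.neg_mem (hf m)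

theorem mem_Lq {f : SymA} : f ∈ Lq ↔ ∀ m, tc m f ∈ ZA := Iff.rfl

theorem smul_mem_Lq {f : SymA} {c : F} (hc : c ∈ ZA) (hf : f ∈ Lq) : c • f ∈ Lq := by
  intro m
  rw [tc, coeff_smul, smul_eq_mul, mul_assoc]; exact ZA.mul_mem hc (hf m)

theorem perp_mem_Lq {f : SymA} (k : ℕ+) (hf : f ∈ Lq) : perp k f ∈ Lq := by
  intro m
  rw [tc_perp]; exact hf _

def qq (m : Exp) : SymA := monomial m (zalpha m)⁻¹

theorem tc_qq (m m' : Exp) : tc m' (qq m) = if m = m' then 1 else 0 := by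
  rw [tc, qq, coeff_monomial]
  split_ifs with h
  · subst h; exact inv_mul_cancel₀ (zalpha_ne_zero _)
  · rw [zero_mul]

theorem qq_mem_Lq (m : Exp) : qq m ∈ Lq := by
  intro m'
  rw [tc_qq]; split_ifs
  · exact ZA.one_mem
  · exact ZA.zero_mem

theorem qq_mem_Lam (m : Exp) : qq m ∈ Lam (wt m) := monomial_mem_Lam _ _

theorem eq_of_tc {f g : SymA} (h : ∀ m, tc m f = tc m g) : f = g := by
  ext m
  exact mul_right_cancel₀ (zalpha_ne_zero m) (h m)

theorem tc_add (m : Exp) (f g : SymA) : tc m (f + g) = tc m f + tc m g := by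
  rw [tc, tc, tc, coeff_add, add_mul]
theorem tc_smul (m : Exp) (c : F) (f : SymA) : tc m (c • f) = c * tc m f := by
  rw [tc, tc, coeff_smul, smul_eq_mul, mul_assoc]
theorem tc_sum {ι : Type*} (m : Exp) (s : Finset ι) (f : ι → SymA) :
    tc m (∑ i ∈ s, f i) = ∑ i ∈ s, tc m (f i) := by
  simp only [tc]
  rw [coeff_sum, Finset.sum_mul]

theorem eq_sum_qq (f : SymA) : f = ∑ m ∈ f.support, tc m f • qq m := by
  conv_lhs => rw [f.as_sum]
  refine Finset.sum_congr rfl fun m _ => ?_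
  rw [qq, smul_monomial, tc, smul_eq_mul, mul_assoc, mul_inv_cancel₀ (zalpha_ne_zero m), mul_one]

theorem perp_qq (k : ℕ+) (m : Exp) : perp k (qq (m + Finsupp.single k 1)) = qq m := by
  apply eq_of_tc
  intro m'
  rw [tc_perp, tc_qq, tc_qq]
  simp

theorem perp_qq_zero (k : ℕ+) (m : Exp) (h : m k = 0) : perp k (qq m) = 0 := by
  apply eq_of_tc
  intro m'
  rw [tc_perp, tc_qq, if_neg]
  · simp [tc]
  · rintro rfl; simp at h

theorem X_mul_qq (k : ℕ+) (m : Exp) :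
    X k * qq m = (alpha * ((k : ℕ) : F) * ((m k : F) + 1)) • qq (m + Finsupp.single k 1) := by
  rw [qq, qq, X, monomial_mul, smul_monomial, one_mul, add_comm, zalpha_add_single, smul_eq_mul]
  congr 1
  have h1 := zalpha_ne_zero (m + Finsupp.single k 1)
  rw [zalpha_add_single, mul_ne_zero_iff] at h1
  rw [mul_inv, mul_left_comm, mul_inv_cancel₀ h1.2, mul_one]

theorem qq_zero : qq 0 = 1 := by
  rw [qq, zalpha_zero, inv_one]; rfl

theorem X_mul_mem_Lq {f : SymA} (k : ℕ+) (hf : f ∈ Lq) : X k * f ∈ Lq := by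
  rw [eq_sum_qq f, Finset.mul_sum]
  refine AddSubgroup.sum_mem _ fun m _ => ?_
  rw [mul_smul_comm, X_mul_qq]
  refine smul_mem_Lq (hf m) (smul_mem_Lq ?_ (qq_mem_Lq _))
  exact ZA.mul_mem (ZA.mul_mem alpha_mem_ZA (natCast_mem _ _)) (ZA.add_mem (natCast_mem _ _) ZA.one_mem)

/-! ### Operators on polynomials -/

section Ops

variable {K : Type} [Field K] {N : ℕ}

/-- permutation operators -/
def Sg (K : Type) [Field K] {N : ℕ} (σ : Equiv.Perm (Fin N)) : Module.End K (MvPolynomial (Fin N) K) :=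
  (rename σ : MvPolynomial (Fin N) K →ₐ[K] MvPolynomial (Fin N) K).toLinearMap

/-- multiplication operators -/
def xm (K : Type) [Field K] {N : ℕ} (i : Fin N) : Module.End K (MvPolynomial (Fin N) K) :=
  LinearMap.mulLeft K (X i)

theorem Sg_apply (σ : Equiv.Perm (Fin N)) (f : MvPolynomial (Fin N) K) : Sg K σ f = rename σ f := rfl
theorem xm_apply (i : Fin N) (f : MvPolynomial (Fin N) K) : xm K i f = X i * f := rfl

theorem Sg_mul (σ τ : Equiv.Perm (Fin N)) : Sg K (σ * τ) = Sg K σ * Sg K τ := by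
  refine LinearMap.ext fun f => ?_
  simp [Sg_apply, rename_rename, Equiv.Perm.coe_mul]

theorem Sg_one : Sg K (1 : Equiv.Perm (Fin N)) = 1 := by
  refine LinearMap.ext fun f => ?_
  simp [Sg_apply]

theorem Sg_xm (σ : Equiv.Perm (Fin N)) (i : Fin N) : Sg K σ * xm K i = xm K (σ i) * Sg K σ := by
  refine LinearMap.ext fun f => ?_
  simp [Sg_apply, xm_apply]

theorem dd_exists (i j : Fin N) (f : MvPolynomial (Fin N) K) :
    ∃ g, (X i - X j) * g = f - rename (Equiv.swap i j) f := by
  induction f using MvPolynomial.induction_on with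
  | C c => exact ⟨0, by simp⟩
  | add p q hp hq =>
    obtain ⟨u, hu⟩ := hp
    obtain ⟨v, hv⟩ := hq
    exact ⟨u + v, by rw [mul_add, hu, hv, map_add]; ring⟩
  | mul_X p k hp =>
    obtain ⟨u, hu⟩ := hp
    rcases eq_or_ne k i with rfl | hi
    · refine ⟨u * X k + rename (Equiv.swap k j) p, ?_⟩
      rw [map_mul, rename_X, Equiv.swap_apply_left]
      linear_combination (X k) * hu
    · rcases eq_or_ne k j with rfl | hj
      · refine ⟨u * X k - rename (Equiv.swap i k) p, ?_⟩
        rw [map_mul, rename_X, Equiv.swap_apply_right]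
        linear_combination (X k) * hu
      · refine ⟨u * X k, ?_⟩
        rw [map_mul, rename_X, Equiv.swap_apply_of_ne_of_ne hi hj]
        linear_combination (X k) * hu

theorem X_sub_X_ne {i j : Fin N} (h : i ≠ j) : (X i - X j : MvPolynomial (Fin N) K) ≠ 0 := by
  rw [sub_ne_zero]
  exact fun hc => h (X_injective hc)

def ddf (i j : Fin N) (f : MvPolynomial (Fin N) K) : MvPolynomial (Fin N) K :=
  if i = j then 0 else Classical.choose (dd_exists i j f)

theorem ddf_spec {i j : Fin N} (h : i ≠ j) (f : MvPolynomial (Fin N) K) :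
    (X i - X j) * ddf i j f = f - rename (Equiv.swap i j) f := by
  rw [ddf, if_neg h]
  exact Classical.choose_spec (dd_exists i j f)

def Aop (K : Type) [Field K] {N : ℕ} (i j : Fin N) : Module.End K (MvPolynomial (Fin N) K) where
  toFun f := X i * ddf i j f
  map_add' f g := by
    rcases eq_or_ne i j with rfl | h
    · simp [ddf]
    · apply mul_left_cancel₀ (X_sub_X_ne h)
      have := ddf_spec h (f + g)
      rw [map_add] at this
      linear_combination (X i) * this - (X i) * ddf_spec h f - (X i) * ddf_spec h g
  map_smul' c f := by
    rcases eq_or_ne i j with rfl | h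
    · simp [ddf]
    · apply mul_left_cancel₀ (X_sub_X_ne h)
      have := ddf_spec h (c • f)
      rw [map_smul] at this
      rw [RingHom.id_apply]
      simp only [MvPolynomial.smul_eq_C_mul] at *
      linear_combination (X i) * this - (X i) * (C c) * ddf_spec h f

theorem Aop_self (i : Fin N) : Aop K i i = 0 := by
  refine LinearMap.ext fun f => ?_
  simp [Aop, ddf]

theorem Aop_spec {i j : Fin N} (h : i ≠ j) (f : MvPolynomial (Fin N) K) :
    (X i - X j) * Aop K i j f = X i * (f - rename (Equiv.swap i j) f) := by
  rw [← ddf_spec h]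
  change _ * (X i * ddf i j f) = _
  ring

theorem Aop_eq {i j : Fin N} (h : i ≠ j) {f g : MvPolynomial (Fin N) K}
    (hg : (X i - X j) * g = X i * (f - rename (Equiv.swap i j) f)) : Aop K i j f = g := by
  apply mul_left_cancel₀ (X_sub_X_ne h)
  rw [Aop_spec h, hg]

theorem Aop_one (i j : Fin N) : Aop K i j 1 = 0 := by
  rcases eq_or_ne i j with rfl | h
  · simp [Aop_self]
  · exact Aop_eq h (by simp)

theorem Sg_Aop (σ : Equiv.Perm (Fin N)) (i j : Fin N) :
    Sg K σ * Aop K i j = Aop K (σ i) (σ j) * Sg K σ := by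
  rcases eq_or_ne i j with rfl | h
  · simp [Aop_self]
  refine LinearMap.ext fun f => ?_
  symm
  change Aop K (σ i) (σ j) (Sg K σ f) = Sg K σ (Aop K i j f)
  apply Aop_eq (by simpa using h)
  have := congrArg (rename σ) (Aop_spec h f)
  simp only [map_mul, map_sub, rename_X, rename_rename] at this
  simp only [Sg_apply, rename_rename]
  rw [this]
  congr 3
  have : σ ∘ Equiv.swap i j = Equiv.swap (σ i) (σ j) ∘ σ := by
    ext k
    simp [Equiv.swap_apply_def]
    split_ifs <;> simp_all
  rw [this]

theorem Aop_xm_of_ne {i j k : Fin N} (hi : k ≠ i) (hj : k ≠ j) :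
    Aop K i j * xm K k = xm K k * Aop K i j := by
  rcases eq_or_ne i j with rfl | h
  · simp [Aop_self]
  refine LinearMap.ext fun f => ?_
  simp only [Module.End.mul_apply, xm_apply]
  apply Aop_eq h
  rw [map_mul, rename_X, Equiv.swap_apply_of_ne_of_ne hi hj]
  linear_combination (X k) * Aop_spec h f

theorem Aop_xm_right {i j : Fin N} (h : i ≠ j) :
    Aop K i j * xm K j = xm K j * Aop K i j - xm K i * Sg K (Equiv.swap i j) := by
  refine LinearMap.ext fun f => ?_
  simp only [Module.End.mul_apply, LinearMap.sub_apply, xm_apply, Sg_apply]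
  apply Aop_eq h
  rw [map_mul, rename_X, Equiv.swap_apply_right]
  linear_combination (X j) * Aop_spec h f

theorem Aop_xm_left {i j : Fin N} (h : i ≠ j) :
    Aop K i j * xm K i = xm K i * Aop K i j + xm K i * Sg K (Equiv.swap i j) := by
  refine LinearMap.ext fun f => ?_
  simp only [Module.End.mul_apply, LinearMap.add_apply, xm_apply, Sg_apply]
  apply Aop_eq h
  rw [map_mul, rename_X, Equiv.swap_apply_left]
  linear_combination (X i) * Aop_spec h f

/-- linearity over symmetric elements -/
theorem Aop_mul_inv (i j : Fin N) (f g : MvPolynomial (Fin N) K)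
    (hg : rename (Equiv.swap i j) g = g) : Aop K i j (f * g) = Aop K i j f * g := by
  rcases eq_or_ne i j with rfl | h
  · simp [Aop_self]
  apply Aop_eq h
  rw [map_mul, hg]
  linear_combination g * Aop_spec h f

/-- Euler operators -/
def Eop (K : Type) [Field K] {N : ℕ} (i : Fin N) : Module.End K (MvPolynomial (Fin N) K) :=
  xm K i * (pderiv i).toLinearMap

theorem Eop_apply (i : Fin N) (f : MvPolynomial (Fin N) K) : Eop K i f = X i * pderiv i f := rfl

theorem Sg_Eop (σ : Equiv.Perm (Fin N)) (i : Fin N) : Sg K σ * Eop K i = Eop K (σ i) * Sg K σ := by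
  refine LinearMap.ext fun f => ?_
  change rename σ (X i * pderiv i f) = X (σ i) * pderiv (σ i) (rename σ f)
  rw [pderiv_rename σ.injective, map_mul, rename_X]

theorem Eop_xm_of_ne {i k : Fin N} (h : k ≠ i) : Eop K i * xm K k = xm K k * Eop K i := by
  refine LinearMap.ext fun f => ?_
  change X i * pderiv i (X k * f) = X k * (X i * pderiv i f)
  rw [pderiv_mul, pderiv_X_of_ne h]
  ring

theorem Eop_xm_self (i : Fin N) : Eop K i * xm K i = xm K i * Eop K i + xm K i := by
  refine LinearMap.ext fun f => ?_
  change X i * pderiv i (X i * f) = X i * (X i * pderiv i f) + X i * f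
  rw [pderiv_mul, pderiv_X_self]
  ring

variable (a : K)

def Zop (a : K) (i : Fin N) : Module.End K (MvPolynomial (Fin N) K) :=
  a • Eop K i + ∑ j, Aop K i j

theorem Zop_one (i : Fin N) : Zop a i (1 : MvPolynomial (Fin N) K) = 0 := by
  simp [Zop, Eop_apply, Aop_one]

theorem Sg_Zop (σ : Equiv.Perm (Fin N)) (i : Fin N) : Sg K σ * Zop a i = Zop a (σ i) * Sg K σ := by
  unfold Zop
  rw [mul_add, add_mul, mul_smul_comm, smul_mul_assoc, Sg_Eop, Finset.mul_sum, Finset.sum_mul]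
  congr 1
  rw [← Equiv.sum_comp σ (fun j => Aop K (σ i) j * Sg K σ)]
  exact Finset.sum_congr rfl fun j _ => Sg_Aop σ i j

abbrev sij (K : Type) [Field K] {N : ℕ} (i j : Fin N) : Module.End K (MvPolynomial (Fin N) K) :=
  Sg K (Equiv.swap i j)

theorem Zop_xm_of_ne {i j : Fin N} (h : i ≠ j) :
    Zop a i * xm K j = xm K j * Zop a i - xm K i * sij K i j := by
  unfold Zop
  rw [mul_add, add_mul, mul_smul_comm, smul_mul_assoc, Eop_xm_of_ne h.symm, Finset.mul_sum, Finset.sum_mul]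
  rw [add_sub_assoc]
  congr 1
  rw [← Finset.add_sum_erase _ _ (Finset.mem_univ j), ← Finset.add_sum_erase _ (fun k => xm K j * Aop K i k) (Finset.mem_univ j), Aop_xm_right h]
  have : ∀ k ∈ Finset.univ.erase j, Aop K i k * xm K j = xm K j * Aop K i k := by
    intro k hk
    exact Aop_xm_of_ne h.symm (Finset.ne_of_mem_erase hk).symm
  rw [Finset.sum_congr rfl this]
  abel

theorem Zop_xm_self (i : Fin N) :
    Zop a i * xm K i = xm K i * (Zop a i + a • 1 + ∑ j ∈ Finset.univ.erase i, sij K i j) := by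
  unfold Zop
  rw [add_mul, smul_mul_assoc, Eop_xm_self, Finset.sum_mul, mul_add, mul_add, mul_add, Finset.mul_sum, Finset.mul_sum]
  rw [← Finset.add_sum_erase _ _ (Finset.mem_univ i), ← Finset.add_sum_erase _ (fun k => xm K i * Aop K i k) (Finset.mem_univ i), Aop_self]
  have : ∀ k ∈ Finset.univ.erase i, Aop K i k * xm K i = xm K i * Aop K i k + xm K i * sij K i k := by
    intro k hk
    exact Aop_xm_left (Finset.ne_of_mem_erase hk).symm
  rw [Finset.sum_congr rfl this, Finset.sum_add_distrib]
  simp only [smul_add, mul_smul_comm, mul_one, zero_mul, mul_zero, zero_add]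
  abel

theorem sij_self_mul (i j : Fin N) : sij K i j * sij K i j = 1 := by
  rw [← Sg_mul, Equiv.swap_mul_self, Sg_one]

theorem sij_comm (i j : Fin N) : sij K i j = sij K j i := by
  rw [sij, Equiv.swap_comm]

/-- abstract computations in a ring -/
theorem ring_aux1 {R : Type} [Ring R] (xi xj xk Zi Zj sij sik sjk : R)
    (h1 : Zi * xk = xk * Zi - xi * sik) (h2 : Zj * xk = xk * Zj - xj * sjk)
    (h3 : Zi * xj = xj * Zi - xi * sij) (h4 : Zj * xi = xi * Zj - xj * sij)
    (h5 : sik * Zj = Zj * sik) (h6 : sjk * Zi = Zi * sjk)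
    (h7 : sij * xk = xk * sij) (h8 : sij * xi = xj * sij) (h9 : sij * xj = xi * sij) :
    (Zi * Zj - Zj * Zi - sij * (Zi - Zj)) * xk = xk * (Zi * Zj - Zj * Zi - sij * (Zi - Zj)) := by
  linear_combination (norm := noncomm_ring) Zi * h2 - Zj * h1 + h1 * Zj - h2 * Zi
    - h3 * sjk + h4 * sik - xi * h5 + xj * h6 - sij * h1 + sij * h2 - h7 * Zi + h7 * Zj + h8 * sik - h9 * sjk

theorem ring_aux2 {R : Type} [Ring R] (xi xj Zi Zj s B : R)
    (h1 : Zi * xi = xi * (Zi + B)) (h3 : Zi * xj = xj * Zi - xi * s) (h4 : Zj * xi = xi * Zj - xj * s)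
    (h5 : s * Zj = Zi * s) (h6 : s * Zi = Zj * s) (h9 : s * xj = xi * s)
    (h8 : s * xi = xj * s) (hB : B * Zj - Zj * B = s * Zj - Zj * s) :
    (Zi * Zj - Zj * Zi - s * (Zi - Zj)) * xi = xi * (Zi * Zj - Zj * Zi - s * (Zi - Zj)) := by
  linear_combination (norm := noncomm_ring) Zi * h4 + h1 * Zj - h3 * s  - Zj * h1 - h4 * (Zi + B) 
    + xi * hB - s * h1 + s * h4 - h8 * (Zi + B) + h8 * Zj + xj * h5 + xi * h6 + 0 - h9 * s

theorem end_eq_zero_of_comm (T : Module.End K (MvPolynomial (Fin N) K)) (h1 : T 1 = 0)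
    (h : ∀ k, T * xm K k = xm K k * T) : T = 0 := by
  refine LinearMap.ext fun f => ?_
  induction f using MvPolynomial.induction_on with
  | C c =>
    have : (C c : MvPolynomial (Fin N) K) = c • 1 := by rw [smul_eq_C_mul, mul_one]
    rw [this, map_smul, h1, smul_zero]; rfl
  | add p q hp hq => rw [map_add, hp, hq]; simp
  | mul_X p k hp =>
    have := LinearMap.congr_fun (h k) p
    simp only [Module.End.mul_apply, xm_apply, LinearMap.zero_apply] at this hp ⊢
    rw [mul_comm, this, hp, mul_zero]

theorem Sg_comm_Zop {σ : Equiv.Perm (Fin N)} {i : Fin N} (h : σ i = i) :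
    Sg K σ * Zop a i = Zop a i * Sg K σ := by
  rw [Sg_Zop, h]

theorem Zop_comm_aux {i j : Fin N} (h : i ≠ j) :
    (Zop a i * Zop a j - Zop a j * Zop a i - sij K i j * (Zop a i - Zop a j)) * xm K i
     = xm K i * (Zop a i * Zop a j - Zop a j * Zop a i - sij K i j * (Zop a i - Zop a j)) := by
  have h5 : sij K i j * Zop a j = Zop a i * sij K i j := by
    rw [Sg_Zop, Equiv.swap_apply_right]
  have h6 : sij K i j * Zop a i = Zop a j * sij K i j := by
    rw [Sg_Zop, Equiv.swap_apply_left]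
  apply ring_aux2 (xm K i) (xm K j) (Zop a i) (Zop a j) (sij K i j)
    (a • 1 + ∑ j ∈ Finset.univ.erase i, sij K i j)
  · rw [Zop_xm_self, add_assoc]
  · exact Zop_xm_of_ne a h
  · rw [sij_comm]; exact Zop_xm_of_ne a h.symm
  · exact h5
  · exact h6
  · rw [Sg_xm, Equiv.swap_apply_right]
  · rw [Sg_xm, Equiv.swap_apply_left]
  · rw [← Finset.add_sum_erase (Finset.univ.erase i) _ (Finset.mem_erase.2 ⟨h.symm, Finset.mem_univ j⟩)]
    have : (∑ l ∈ (Finset.univ.erase i).erase j, sij K i l) * Zop a j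
      = Zop a j * (∑ l ∈ (Finset.univ.erase i).erase j, sij K i l) := by
      rw [Finset.mul_sum, Finset.sum_mul]
      refine Finset.sum_congr rfl fun l hl => ?_
      apply Sg_comm_Zop
      exact Equiv.swap_apply_of_ne_of_ne h.symm (Finset.ne_of_mem_erase hl).symm
    rw [add_mul, add_mul, mul_add, mul_add, this, smul_mul_assoc, mul_smul_comm, one_mul, mul_one]
    abel

theorem Zop_comm {i j : Fin N} (h : i ≠ j) :
    Zop a i * Zop a j - Zop a j * Zop a i = sij K i j * (Zop a i - Zop a j) := by
  rw [← sub_eq_zero]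
  apply end_eq_zero_of_comm
  · simp [Zop_one]
  · intro k
    rcases eq_or_ne k i with rfl | hi
    · exact Zop_comm_aux a h
    · rcases eq_or_ne k j with rfl | hj
      · have := Zop_comm_aux a h.symm
        have e : Zop a i * Zop a k - Zop a k * Zop a i - sij K i k * (Zop a i - Zop a k)
           = -(Zop a k * Zop a i - Zop a i * Zop a k - sij K k i * (Zop a k - Zop a i)) := by
          rw [sij_comm, mul_sub, mul_sub]; abel
        rw [e]; exact (neg_mul _ _).trans ((congrArg Neg.neg this).trans (mul_neg _ _).symm)
      · apply ring_aux1 (xm K i) (xm K j) (xm K k) (Zop a i) (Zop a j) (sij K i j) (sij K i k) (sij K j k)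
        · exact Zop_xm_of_ne a hi.symm
        · exact Zop_xm_of_ne a hj.symm
        · exact Zop_xm_of_ne a h
        · rw [sij_comm]; exact Zop_xm_of_ne a h.symm
        · exact Sg_comm_Zop a (Equiv.swap_apply_of_ne_of_ne h.symm hj.symm)
        · exact Sg_comm_Zop a (Equiv.swap_apply_of_ne_of_ne h hi.symm)
        · rw [Sg_xm, Equiv.swap_apply_of_ne_of_ne hi hj]
        · rw [Sg_xm, Equiv.swap_apply_left]
        · rw [Sg_xm, Equiv.swap_apply_right]

end Ops

section Ops2

variable {K : Type} [Field K] {N : ℕ} (a : K)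

theorem Sg_sij (σ : Equiv.Perm (Fin N)) (i j : Fin N) :
    Sg K σ * sij K i j = sij K (σ i) (σ j) * Sg K σ := by
  rw [← Sg_mul, ← Sg_mul]
  congr 1
  ext k
  simp only [Equiv.Perm.coe_mul, Function.comp_apply, Equiv.swap_apply_def, EmbeddingLike.apply_eq_iff_eq]
  split_ifs <;> simp_all

def Yop (a : K) (i : Fin N) : Module.End K (MvPolynomial (Fin N) K) :=
  Zop a i + ∑ j ∈ Finset.Ioi i, sij K i j

theorem Sg_sum_sij (σ : Equiv.Perm (Fin N)) (i : Fin N) (hσ : σ i = i)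
    (h : ∀ l, i < l → i < σ l) :
    Sg K σ * ∑ j ∈ Finset.Ioi i, sij K i j = (∑ j ∈ Finset.Ioi i, sij K i j) * Sg K σ := by
  rw [Finset.mul_sum, Finset.sum_mul]
  refine Finset.sum_bij (fun l _ => σ l) ?_ ?_ ?_ ?_
  · intro l hl; simpa using h l (by simpa using hl)
  · intro l _ l' _ hll; simpa using hll
  · intro l hl
    -- surjectivity by finiteness
    have himg : (Finset.Ioi i).image σ = Finset.Ioi i := by
      apply Finset.eq_of_subset_of_card_le
      · intro l hl
        obtain ⟨l', hl', rfl⟩ := Finset.mem_image.1 hl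
        simpa using h l' (by simpa using hl')
      · rw [Finset.card_image_of_injective _ σ.injective]
    rw [← himg] at hl
    obtain ⟨l', hl', rfl⟩ := Finset.mem_image.1 hl
    exact ⟨l', hl', rfl⟩
  · intro l _
    rw [Sg_sij, hσ]

theorem Sg_comm_Yop (σ : Equiv.Perm (Fin N)) (i : Fin N) (hσ : σ i = i)
    (h : ∀ l, i < l → i < σ l) : Sg K σ * Yop a i = Yop a i * Sg K σ := by
  unfold Yop
  rw [mul_add, add_mul, Sg_sum_sij σ i hσ h, Sg_comm_Zop a hσ]

theorem ring_aux3 {R : Type} [Ring R] (Zi Zj s P B : R)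
    (h : Zi * Zj - Zj * Zi = s * (Zi - Zj)) (h1 : P * Zj = Zj * P) (h2 : s * Zj = Zi * s)
    (h3 : s * Zi = Zj * s)
    (h4 : Zi * B = B * Zi) (h5 : P * B + s * B = B * P + B * s) :
    (Zi + (s + P)) * (Zj + B) = (Zj + B) * (Zi + (s + P)) := by
  linear_combination (norm := noncomm_ring) h + h1 + h4 + h5 + h3

theorem Yop_comm_aux {i j : Fin N} (h : i < j) : Yop a i * Yop a j = Yop a j * Yop a i := by
  unfold Yop
  rw [← Finset.add_sum_erase (Finset.Ioi i) (fun l => sij K i l) (Finset.mem_Ioi.2 h)]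
  apply ring_aux3
  · exact Zop_comm a h.ne
  · rw [Finset.mul_sum, Finset.sum_mul]
    refine Finset.sum_congr rfl fun l hl => ?_
    apply Sg_comm_Zop
    exact Equiv.swap_apply_of_ne_of_ne h.ne' (Finset.ne_of_mem_erase hl).symm
  · rw [Sg_Zop, Equiv.swap_apply_right]
  · rw [Sg_Zop, Equiv.swap_apply_left]
  · rw [Finset.mul_sum, Finset.sum_mul]
    refine Finset.sum_congr rfl fun l hl => ?_
    symm
    apply Sg_comm_Zop
    have : j < l := by simpa using hl
    exact Equiv.swap_apply_of_ne_of_ne h.ne (h.trans this).ne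
  · rw [← add_mul, ← mul_add, add_comm, Finset.add_sum_erase (Finset.Ioi i) (fun l => sij K i l) (Finset.mem_Ioi.2 h)]
    rw [Finset.mul_sum, Finset.sum_mul (Finset.Ioi j)]
    refine Finset.sum_congr rfl fun l hl => ?_
    have hl : j < l := by simpa using hl
    symm
    apply Sg_sum_sij
    · exact Equiv.swap_apply_of_ne_of_ne h.ne (h.trans hl).ne
    · intro m hm
      rw [Equiv.swap_apply_def]
      split_ifs
      · exact h.trans hl
      · exact h
      · exact hm

theorem Yop_comm (i j : Fin N) : Yop a i * Yop a j = Yop a j * Yop a i := by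
  rcases lt_trichotomy i j with h | rfl | h
  · exact Yop_comm_aux a h
  · rfl
  · exact (Yop_comm_aux a h).symm

def cop (a : K) (N k : ℕ) : Module.End K (MvPolynomial (Fin N) K) := ∑ i, Yop a i ^ k

theorem cop_comm_Yop (k : ℕ) (i : Fin N) : cop a N k * Yop a i = Yop a i * cop a N k := by
  unfold cop
  rw [Finset.mul_sum, Finset.sum_mul]
  refine Finset.sum_congr rfl fun l _ => ?_
  exact (Commute.pow_left (show Commute _ _ from Yop_comm a l i) k)

theorem cop_comm_cop (k l : ℕ) : cop a N k * cop a N l = cop a N l * cop a N k := by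
  conv_lhs => rw [cop.eq_1 a N l]
  conv_rhs => rw [cop.eq_1 a N l]
  rw [Finset.mul_sum, Finset.sum_mul]
  refine Finset.sum_congr rfl fun i _ => ?_
  exact (Commute.pow_right (show Commute _ _ from cop_comm_Yop a k i) l)

theorem ring_aux4 {R : Type} [Ring R] (s u v : R) (h1 : s * u = v * s + 1) (h2 : s * v = u * s - 1)
    (h3 : u * v = v * u) (k : ℕ) : s * (u ^ k + v ^ k) = (u ^ k + v ^ k) * s := by
  have e1 : s * (u + v) = (u + v) * s := by
    linear_combination (norm := noncomm_ring) h1 + h2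
  have e2 : s * (u * v) = (u * v) * s := by
    linear_combination (norm := noncomm_ring) h1 * v + v * h2 - h3 * s
  induction k using Nat.strong_induction_on with
  | _ k ih =>
    match k with
    | 0 => simp; noncomm_ring
    | 1 => simpa using e1
    | k + 2 =>
      have r : u ^ (k+2) + v ^ (k+2) = (u + v) * (u ^ (k+1) + v ^ (k+1)) - u * v * (u ^ k + v ^ k) := by
        have a1 : u * v * u ^ k = v * u ^ (k+1) := by rw [h3, mul_assoc, ← pow_succ']
        have a2 : u * v * v ^ k = u * v ^ (k+1) := by rw [mul_assoc, ← pow_succ']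
        rw [mul_add (u * v), a1, a2, add_mul, mul_add, mul_add, pow_succ' u (k+1), pow_succ' v (k+1)]
        abel
      rw [r, mul_sub, sub_mul, ← mul_assoc, e1, mul_assoc (u + v), ih (k+1) (by omega), ← mul_assoc, ← mul_assoc,
        e2, mul_assoc (u * v) s, ih k (by omega), ← mul_assoc]

theorem sum_Ioi_castSucc {M : ℕ} {R : Type*} [AddCommMonoid R] (i : Fin M) (f : Fin (M+1) → R) :
    ∑ j ∈ Finset.Ioi i.castSucc, f j = f i.succ + ∑ j ∈ Finset.Ioi i.succ, f j := by
  have : Finset.Ioi i.castSucc = insert i.succ (Finset.Ioi i.succ) := by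
    ext l
    simp only [Finset.mem_Ioi, Finset.mem_insert, Fin.lt_def, Fin.ext_iff, Fin.val_castSucc, Fin.val_succ]
    omega
  rw [this, Finset.sum_insert (by simp)]

theorem sij_Yop_left {M : ℕ} (i : Fin M) :
    sij K i.castSucc i.succ * Yop a i.castSucc = Yop a i.succ * sij K i.castSucc i.succ + 1 := by
  unfold Yop
  rw [sum_Ioi_castSucc, mul_add, mul_add, sij_self_mul, Sg_Zop, Equiv.swap_apply_left, add_mul,
    Finset.mul_sum, Finset.sum_mul, add_assoc, add_comm (∑ j ∈ Finset.Ioi i.succ, sij K i.succ j * _)]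
  congr 2
  refine Finset.sum_congr rfl fun l hl => ?_
  rw [Sg_sij, Equiv.swap_apply_left, Equiv.swap_apply_of_ne_of_ne]
  · have : i.succ < l := by simpa using hl
    exact (Fin.castSucc_lt_succ.trans this).ne'
  · have : i.succ < l := by simpa using hl
    exact this.ne'

theorem sij_Yop_right {M : ℕ} (i : Fin M) :
    sij K i.castSucc i.succ * Yop a i.succ = Yop a i.castSucc * sij K i.castSucc i.succ - 1 := by
  have h := sij_Yop_left a i
  have h1 := sij_self_mul (K := K) i.castSucc i.succ
  have h2 : ∀ s u v : Module.End K (MvPolynomial (Fin (M+1)) K), s * u = v * s + 1 → s * s = 1 →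
      s * v = u * s - 1 := by
    intro s u v h h1
    have e1 : s * (s * u) * s = s * v * (s * s) + s * s := by
      rw [h, mul_add, add_mul, mul_one]; simp only [mul_assoc]
    rw [← mul_assoc, h1, one_mul, mul_one] at e1
    rw [e1]; abel
  exact h2 _ _ _ h h1

theorem sij_comm_cop {M : ℕ} (i : Fin M) (k : ℕ) :
    sij K i.castSucc i.succ * cop a (M+1) k = cop a (M+1) k * sij K i.castSucc i.succ := by
  unfold cop
  have hne : i.succ ≠ i.castSucc := Fin.castSucc_lt_succ.ne'
  rw [← Finset.add_sum_erase _ _ (Finset.mem_univ i.castSucc),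
    ← Finset.add_sum_erase (Finset.univ.erase _) _ (Finset.mem_erase.2 ⟨hne, Finset.mem_univ i.succ⟩), ← add_assoc,
    mul_add, add_mul, ring_aux4 _ _ _ (sij_Yop_left a i) (sij_Yop_right a i) (Yop_comm a _ _) k,
    Finset.mul_sum, Finset.sum_mul]
  congr 1
  refine Finset.sum_congr rfl fun l hl => ?_
  have hl1 : l ≠ i.succ := Finset.ne_of_mem_erase hl
  have hl2 : l ≠ i.castSucc := Finset.ne_of_mem_erase (Finset.mem_of_mem_erase hl)
  refine Commute.pow_right (show Commute _ _ from ?_) k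
  apply Sg_comm_Yop
  · exact Equiv.swap_apply_of_ne_of_ne hl2 hl1
  · intro m hm
    rw [Equiv.swap_apply_def]
    simp only [Ne, Fin.ext_iff, Fin.lt_def, Fin.val_castSucc, Fin.val_succ] at *
    split_ifs <;> simp <;> omega

theorem Sg_comm_cop {M : ℕ} (σ : Equiv.Perm (Fin (M+1))) (k : ℕ) :
    Sg K σ * cop a (M+1) k = cop a (M+1) k * Sg K σ := by
  have : σ ∈ Submonoid.closure (Set.range fun i : Fin M => Equiv.swap i.castSucc i.succ) := by
    rw [Equiv.Perm.mclosure_swap_castSucc_succ]; trivial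
  induction this using Submonoid.closure_induction with
  | mem x hx =>
    obtain ⟨i, rfl⟩ := hx
    exact sij_comm_cop a i k
  | one => rw [Sg_one]; simp
  | mul x y _ _ hx hy => rw [Sg_mul, mul_assoc, hy, ← mul_assoc, hx, mul_assoc]

theorem Zop_comm_cop {M : ℕ} (i : Fin (M+1)) (k : ℕ) :
    Zop a i * cop a (M+1) k = cop a (M+1) k * Zop a i := by
  have : Zop a i = Yop a i - ∑ j ∈ Finset.Ioi i, sij K i j := by rw [Yop]; abel
  rw [this, sub_mul, mul_sub, cop_comm_Yop, Finset.mul_sum, Finset.sum_mul]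
  congr 1
  exact Finset.sum_congr rfl fun l _ => Sg_comm_cop a _ k

theorem Sg_inv_mul {M : ℕ} (σ : Equiv.Perm (Fin M)) : Sg K σ⁻¹ * Sg K σ = 1 := by
  rw [← Sg_mul, inv_mul_cancel, Sg_one]
theorem Sg_mul_inv {M : ℕ} (σ : Equiv.Perm (Fin M)) : Sg K σ * Sg K σ⁻¹ = 1 := by
  rw [← Sg_mul, mul_inv_cancel, Sg_one]

/-- rotated Jucys-Murphy-like elements -/
def Ypp (a : K) {M : ℕ} (j : Fin M) : Module.End K (MvPolynomial (Fin (M+1)) K) :=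
  Zop a j.succ + (sij K 0 j.succ + ∑ l ∈ Finset.Ioi j.succ, sij K j.succ l)

theorem xm_Yop_zero {M : ℕ} :
    xm K (0 : Fin (M+1)) * Yop a 0 = (Zop a 0 - a • 1) * xm K 0 := by
  have h := Zop_xm_self (K := K) (N := M+1) a 0
  have : Finset.univ.erase (0 : Fin (M+1)) = Finset.Ioi 0 := by
    ext l; simp [Fin.pos_iff_ne_zero]
  rw [this, add_right_comm, mul_add] at h
  rw [Yop, sub_mul, h]; simp

theorem xm_Yop_succ {M : ℕ} (j : Fin M) :
    xm K (0 : Fin (M+1)) * Yop a j.succ = Ypp a j * xm K 0 := by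
  have h := Zop_xm_of_ne (K := K) (N := M+1) a (i := j.succ) (j := 0) (Fin.succ_ne_zero j)
  rw [Yop, Ypp, mul_add, add_mul, add_mul, h, Sg_xm, Equiv.swap_apply_left, sij_comm j.succ 0,
    Finset.mul_sum, Finset.sum_mul, ← add_assoc, sub_add_cancel]
  congr 1
  refine Finset.sum_congr rfl fun l hl => ?_
  rw [Sg_xm, Equiv.swap_apply_of_ne_of_ne (Fin.succ_ne_zero j).symm]
  have : j.succ < l := by simpa using hl
  exact ((Fin.succ_pos j).trans this).ne

theorem rot_Yop_last {M : ℕ} :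
    Sg K (finRotate (M+1)) * Yop a (Fin.last M) = Zop a 0 * Sg K (finRotate (M+1)) := by
  have h : (Finset.Ioi (Fin.last M)) = ∅ := by
    ext l; simp [Fin.le_last]
  rw [Yop, h, Finset.sum_empty, add_zero, Sg_Zop, finRotate_last]

theorem rot_Yop_castSucc {M : ℕ} (j : Fin M) :
    Sg K (finRotate (M+1)) * Yop a j.castSucc = Ypp a j * Sg K (finRotate (M+1)) := by
  have hr : ∀ l : Fin M, finRotate (M+1) l.castSucc = l.succ := by
    intro l
    rw [finRotate_succ_apply]; simp
  have hs : Finset.Ioi j.castSucc = insert (Fin.last M) ((Finset.Ioi j).map Fin.castSuccEmb) := by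
    ext l
    refine Fin.lastCases ?_ (fun l => ?_) l
    · simp [Fin.castSucc_lt_last]
    · simp [Fin.le_last]
  have hs2 : Finset.Ioi j.succ = (Finset.Ioi j).map (Fin.succEmb M) := by
    ext l
    refine Fin.cases ?_ (fun l => ?_) l
    · simp
    · simp
  rw [Yop, Ypp, mul_add, add_mul, Sg_Zop, hr, hs, hs2, Finset.sum_insert, mul_add (Sg K (finRotate (M+1))) (sij K _ _), add_mul,
    Sg_sij, hr, finRotate_last, sij_comm 0, Finset.sum_map, Finset.sum_map, Finset.mul_sum, Finset.sum_mul]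
  · congr 2
    refine Finset.sum_congr rfl fun l _ => ?_
    rw [Sg_sij, hr, Fin.coe_castSuccEmb, hr]; rfl
  · simp [Fin.castSucc_ne_last]

theorem cop_rot {M : ℕ} (k : ℕ) :
    cop a (M+1) k = Zop a 0 ^ k + ∑ j : Fin M, Ypp a j ^ k := by
  have h := Sg_comm_cop a (finRotate (M+1)) k
  have hp : ∀ (u v s : Module.End K (MvPolynomial (Fin (M+1)) K)) (k : ℕ), s * u = v * s → s * u ^ k = v ^ k * s := by
    intro u v s k h
    exact (SemiconjBy.pow_right (show SemiconjBy s u v from h) k)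
  have h2 : Sg K (finRotate (M+1)) * cop a (M+1) k = (Zop a 0 ^ k + ∑ j : Fin M, Ypp a j ^ k) * Sg K (finRotate (M+1)) := by
    rw [cop, Fin.sum_univ_castSucc, mul_add, add_mul, hp _ _ _ k (rot_Yop_last a), Finset.mul_sum,
      Finset.sum_mul]
    refine (add_comm _ _).trans ?_
    congr 1
    exact Finset.sum_congr rfl fun j _ => hp _ _ _ k (rot_Yop_castSucc a j)
  rw [h2] at h
  have := congrArg (fun T => T * Sg K (finRotate (M+1))⁻¹) h
  simp only [mul_assoc, Sg_mul_inv, mul_one] at this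
  exact this.symm

theorem xm_cop {M : ℕ} (k : ℕ) :
    (cop a (M+1) k - Zop a 0 ^ k + (Zop a 0 - a • 1) ^ k) * xm K 0 = xm K 0 * cop a (M+1) k := by
  have hp : ∀ (u v s : Module.End K (MvPolynomial (Fin (M+1)) K)) (k : ℕ), s * u = v * s → s * u ^ k = v ^ k * s := by
    intro u v s k h
    exact (SemiconjBy.pow_right (show SemiconjBy s u v from h) k)
  have h2 : xm K 0 * cop a (M+1) k = ((Zop a 0 - a • 1) ^ k + ∑ j : Fin M, Ypp a j ^ k) * xm K 0 := by
    rw [cop, Fin.sum_univ_succ, mul_add, add_mul, hp _ _ _ k (xm_Yop_zero a), Finset.mul_sum,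
      Finset.sum_mul]
    congr 1
    exact Finset.sum_congr rfl fun j _ => hp _ _ _ k (xm_Yop_succ a j)
  rw [h2, cop_rot]
  congr 1
  abel

/-- the commutative algebra generated by the `cop` -/
def ZZ (a : K) (N : ℕ) : Subalgebra K (Module.End K (MvPolynomial (Fin N) K)) :=
  Algebra.adjoin K (Set.range (cop a N))

theorem ZZ_comm_of {N : ℕ} (T : Module.End K (MvPolynomial (Fin N) K))
    (h : ∀ k, T * cop a N k = cop a N k * T) : ∀ b ∈ ZZ a N, T * b = b * T := by
  intro b hb
  induction hb using Algebra.adjoin_induction with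
  | mem x hx => obtain ⟨k, rfl⟩ := hx; exact h k
  | algebraMap r => exact (Algebra.commutes r T).symm
  | add x y _ _ hx hy => rw [mul_add, add_mul, hx, hy]
  | mul x y _ _ hx hy => rw [← mul_assoc, hx, mul_assoc, hy, mul_assoc]

theorem Zop_comm_ZZ {M : ℕ} (i : Fin (M+1)) : ∀ b ∈ ZZ a (M+1), Zop a i * b = b * Zop a i :=
  ZZ_comm_of a _ fun k => Zop_comm_cop a i k

theorem Sg_comm_ZZ {M : ℕ} (σ : Equiv.Perm (Fin (M+1))) : ∀ b ∈ ZZ a (M+1), Sg K σ * b = b * Sg K σ :=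
  ZZ_comm_of a _ fun k => Sg_comm_cop a σ k

theorem ZZ_comm {M : ℕ} : ∀ b ∈ ZZ a (M+1), ∀ c ∈ ZZ a (M+1), c * b = b * c := by
  intro b hb c hc
  refine ZZ_comm_of a c ?_ b hb
  intro k
  refine (ZZ_comm_of a (cop a (M+1) k) ?_ c hc).symm
  intro l
  exact cop_comm_cop a k l

theorem ZZ_check {M : ℕ} : ∀ b ∈ ZZ a (M+1), ∃ b' : Module.End K (MvPolynomial (Fin (M+1)) K),
    b' * xm K 0 = xm K 0 * b ∧ b' * Zop a 0 = Zop a 0 * b' ∧ ∀ c ∈ ZZ a (M+1), b' * c = c * b' := by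
  intro b hb
  induction hb using Algebra.adjoin_induction with
  | mem x hx =>
    obtain ⟨k, rfl⟩ := hx
    have hZ : Commute (Zop (N := M+1) a 0 - a • 1) (Zop a 0) := by
      apply Commute.sub_left (Commute.refl _)
      exact (Commute.one_left _).smul_left a
    refine ⟨_, xm_cop a k, ?_, ?_⟩
    · refine (show Commute _ _ from ?_)
      refine Commute.add_left (Commute.sub_left ?_ ?_) (hZ.pow_left k)
      · exact (Zop_comm_cop a 0 k).symm
      · exact (Commute.refl _).pow_left k
    · intro c hc
      refine (show Commute _ _ from ?_)
      have hc0 : Commute (Zop a 0) c := Zop_comm_ZZ a 0 c hc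
      refine Commute.add_left (Commute.sub_left ?_ (hc0.pow_left k)) (Commute.pow_left ?_ k)
      · exact ZZ_comm a c hc _ (Algebra.subset_adjoin ⟨k, rfl⟩)
      · exact hc0.sub_left ((Commute.one_left _).smul_left a)
  | algebraMap r =>
    refine ⟨algebraMap K _ r, Algebra.commutes r _, Algebra.commutes r _, fun c _ => Algebra.commutes r _⟩
  | add x y _ _ hx hy =>
    obtain ⟨x', h1, h2, h3⟩ := hx
    obtain ⟨y', h4, h5, h6⟩ := hy
    refine ⟨x' + y', by rw [add_mul, mul_add, h1, h4], by rw [add_mul, mul_add, h2, h5], ?_⟩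
    intro c hc
    rw [add_mul, mul_add, h3 c hc, h6 c hc]
  | mul x y _ _ hx hy =>
    obtain ⟨x', h1, h2, h3⟩ := hx
    obtain ⟨y', h4, h5, h6⟩ := hy
    refine ⟨x' * y', by rw [mul_assoc, h4, ← mul_assoc, h1, mul_assoc], by rw [mul_assoc, h5, ← mul_assoc, h2, mul_assoc], ?_⟩
    intro c hc
    rw [mul_assoc, h6 c hc, ← mul_assoc, h3 c hc, mul_assoc]

end Ops2

/-! ### Evaluations of symmetric functions -/

def pN (N : ℕ) (r : ℕ) : SymA := if r = 0 then C (N : F) else X r.toPNat'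
def perpN (k : ℕ) : SymA →ₗ[F] SymA := perp k.toPNat'

theorem coe_toPNat' {k : ℕ} (h : k ≠ 0) : ((k.toPNat' : ℕ+) : ℕ) = k := by
  simp [Nat.toPNat'_coe, Nat.pos_of_ne_zero h]

theorem toPNat'_coe (k : ℕ+) : ((k : ℕ).toPNat') = k := PNat.coe_toPNat' k

theorem evalN_X (N : ℕ) (k : ℕ+) : evalN N (X k) = ∑ j : Fin N, X j ^ (k : ℕ) := by
  simp [evalN]

theorem evalN_pN (N r : ℕ) : evalN N (pN N r) = ∑ j : Fin N, X j ^ r := by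
  unfold pN
  split_ifs with h
  · subst h
    simp [evalN]
  · rw [evalN_X, coe_toPNat' h]

theorem rename_evalN {N : ℕ} (σ : Equiv.Perm (Fin N)) (f : SymA) :
    rename σ (evalN N f) = evalN N f := by
  have : (rename σ : MvPolynomial (Fin N) F →ₐ[F] _).comp (evalN N) = evalN N := by
    apply MvPolynomial.algHom_ext
    intro k
    rw [AlgHom.comp_apply, evalN_X, map_sum]
    simp only [map_pow, rename_X]
    exact Equiv.sum_comp σ (fun j => (X j : MvPolynomial (Fin N) F) ^ (k : ℕ))
  exact DFunLike.congr_fun this f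

theorem Sg_evalN {N : ℕ} (σ : Equiv.Perm (Fin N)) (f : SymA) :
    Sg F σ (evalN N f) = evalN N f := by
  rw [Sg_apply, rename_evalN]

theorem wt_ge (m : Exp) (k : ℕ+) (h : m k ≠ 0) : (k : ℕ) ≤ wt m := by
  have : m = Finsupp.single k (m k) + m.erase k := (Finsupp.single_add_erase k m).symm
  rw [this, wt_add, wt_single]
  have : 1 * (k : ℕ) ≤ m k * k := Nat.mul_le_mul_right _ (Nat.pos_of_ne_zero h)
  omega

theorem Lam_supported {n : ℕ} {f : SymA} (hf : f ∈ Lam n) :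
    f ∈ supported F {k : ℕ+ | (k : ℕ) ≤ n} := by
  rw [mem_supported]
  intro k hk
  rw [Finset.mem_coe, mem_vars] at hk
  obtain ⟨m, hm, hkm⟩ := hk
  have h1 : wt m = n := by
    by_contra hc
    exact (mem_support_iff.1 hm) (hf m hc)
  have := wt_ge m k (by simpa using hkm)
  simp; omega

theorem Eop_evalN_supported {N n : ℕ} (i : Fin N) {f : SymA}
    (hf : f ∈ supported F {k : ℕ+ | (k : ℕ) ≤ n}) :
    alpha • Eop F i (evalN N f) = ∑ k ∈ Finset.Icc 1 n, X i ^ k * evalN N (perpN k f) := by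
  unfold supported at hf
  induction hf using Algebra.adjoin_induction with
  | mem x hx =>
    obtain ⟨k, hk, rfl⟩ := hx
    have hk : (k : ℕ) ≤ n := hk
    rw [Finset.sum_eq_single (k : ℕ)]
    · rw [perpN, toPNat'_coe, perp_apply, pderiv_X_self, map_smul, map_one, evalN_X, Eop_apply, map_sum,
        Finset.sum_eq_single i]
      · rw [pderiv_pow, pderiv_X_self, mul_smul]
        have : (k : ℕ) = (k : ℕ) - 1 + 1 := by have := k.pos; omega
        rw [mul_smul_comm]
        congr 1
        simp only [smul_eq_C_mul, map_natCast]
        conv_rhs => rw [this, pow_succ]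
        push_cast
        simp only [Nat.cast_sub k.pos, mul_one]
        push_cast
        ring
      · intro j _ hj
        rw [pderiv_pow, pderiv_X_of_ne hj, mul_zero]
      · simp
    · intro j hj hjk
      have hj0 : j ≠ 0 := by have := (Finset.mem_Icc.1 hj).1; omega
      rw [perpN, perp_apply, pderiv_X_of_ne, smul_zero, map_zero, mul_zero]
      rintro rfl
      exact hjk (coe_toPNat' hj0).symm
    · intro h
      exact absurd (Finset.mem_Icc.2 ⟨k.pos, hk⟩) h
  | algebraMap r =>
    rw [Finset.sum_eq_zero]
    · rw [AlgHom.commutes, Eop_apply]; simp [algebraMap_eq]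
    · intro k _
      rw [perpN, perp_apply, algebraMap_eq, pderiv_C, smul_zero, map_zero, mul_zero]
  | add x y _ _ hx hy =>
    simp only [map_add, mul_add, smul_add, Finset.sum_add_distrib, hx, hy]
  | mul x y _ _ hx hy =>
    have h1 : alpha • Eop F i (evalN N (x * y)) =
        (alpha • Eop F i (evalN N x)) * evalN N y + evalN N x * (alpha • Eop F i (evalN N y)) := by
      simp only [map_mul, Eop_apply, pderiv_mul, smul_eq_C_mul]
      ring
    rw [h1, hx, hy, Finset.sum_mul, Finset.mul_sum, ← Finset.sum_add_distrib]
    refine Finset.sum_congr rfl fun k _ => ?_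
    have h2 : perpN k (x * y) = perpN k x * y + x * perpN k y := by
      simp only [perpN, perp_apply, pderiv_mul, smul_eq_C_mul]
      ring
    rw [h2, map_add, map_mul, map_mul]
    ring

theorem Eop_evalN {N n : ℕ} (i : Fin N) {f : SymA} (hf : f ∈ Lam n) :
    alpha • Eop F i (evalN N f) = ∑ k ∈ Finset.Icc 1 n, X i ^ k * evalN N (perpN k f) :=
  Eop_evalN_supported i (Lam_supported hf)

theorem Aop_pow {N : ℕ} {i j : Fin N} (h : i ≠ j) (m : ℕ) :
    Aop F i j (X i ^ m) = ∑ c ∈ Finset.range m, X i ^ (c + 1) * X j ^ (m - 1 - c) := by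
  apply Aop_eq h
  rw [map_pow, rename_X, Equiv.swap_apply_left, ← Commute.mul_geom_sum₂ (Commute.all _ _), mul_left_comm]
  rw [Finset.mul_sum (Finset.range m) _ (X i : MvPolynomial (Fin N) F)]
  congr 1
  refine Finset.sum_congr rfl fun c _ => ?_
  rw [pow_succ']; ring

theorem sum_Aop_pow {N : ℕ} (i : Fin N) (m : ℕ) :
    ∑ j, Aop F i j (X i ^ m) =
      (∑ c ∈ Finset.range m, X i ^ (c + 1) * evalN N (pN N (m - 1 - c))) - (m : F) • X i ^ m := by
  rw [← Finset.add_sum_erase _ _ (Finset.mem_univ i), Aop_self]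
  have h1 : ∀ j ∈ Finset.univ.erase i, Aop F i j (X i ^ m) =
     ∑ c ∈ Finset.range m, X i ^ (c + 1) * X j ^ (m - 1 - c) := by
    intro j hj
    exact Aop_pow (Finset.ne_of_mem_erase hj).symm m
  rw [Finset.sum_congr rfl h1, Finset.sum_comm, LinearMap.zero_apply, zero_add, eq_sub_iff_add_eq]
  have h2 : (m : F) • (X i ^ m : MvPolynomial (Fin N) F) =
      ∑ c ∈ Finset.range m, X i ^ (c + 1) * X i ^ (m - 1 - c) := by
    have : ∀ c ∈ Finset.range m, (X i ^ (c + 1) * X i ^ (m - 1 - c) : MvPolynomial (Fin N) F) = X i ^ m := by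
      intro c hc
      rw [← pow_add]; congr 1; have := Finset.mem_range.1 hc; omega
    rw [Finset.sum_congr rfl this]
    simp [smul_eq_C_mul]
  rw [h2, ← Finset.sum_add_distrib]
  refine Finset.sum_congr rfl fun c _ => ?_
  rw [evalN_pN, ← Finset.mul_sum, ← mul_add, Finset.sum_erase_add _ _ (Finset.mem_univ i)]

theorem Zop_formula {N n : ℕ} (i : Fin N) (m : ℕ) {f : SymA} (hf : f ∈ Lam n) :
    Zop alpha i (X i ^ m * evalN N f) =
      ((alpha - 1) * m) • (X i ^ m * evalN N f)
      + ∑ k ∈ Finset.Icc 1 n, X i ^ (m + k) * evalN N (perpN k f)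
      + ∑ c ∈ Finset.range m, X i ^ (c + 1) * evalN N (pN N (m - 1 - c) * f) := by
  have h1 : Eop F i (X i ^ m * evalN N f) = (m : F) • (X i ^ m * evalN N f) + X i ^ m * Eop F i (evalN N f) := by
    rw [Eop_apply, pderiv_mul, pderiv_pow, pderiv_X_self, Eop_apply, smul_eq_C_mul, map_natCast]
    rcases m with _ | m
    · simp
    · simp [pow_succ]; ring
  have h2 : ∑ j, Aop F i j (X i ^ m * evalN N f) = (∑ j, Aop F i j (X i ^ m)) * evalN N f := by
    rw [Finset.sum_mul]
    exact Finset.sum_congr rfl fun j _ => Aop_mul_inv i j _ _ (rename_evalN _ f)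
  have h3 := Eop_evalN (N := N) i hf
  rw [Zop, LinearMap.add_apply, LinearMap.smul_apply, h1, LinearMap.sum_apply, h2, sum_Aop_pow, sub_mul,
    Finset.sum_mul, smul_add, ← mul_smul_comm alpha (X i ^ m) (Eop F i _), h3, Finset.mul_sum]
  have h4 : ∀ c ∈ Finset.range m, X i ^ (c + 1) * evalN N (pN N (m - 1 - c)) * evalN N f
     = X i ^ (c + 1) * evalN N (pN N (m - 1 - c) * f) := by
    intro c _
    rw [map_mul]; ring
  have h5 : ∀ k ∈ Finset.Icc 1 n, (X i ^ m : MvPolynomial (Fin N) F) * (X i ^ k * evalN N (perpN k f))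
     = X i ^ (m + k) * evalN N (perpN k f) := by
    intro c _
    rw [pow_add]; ring
  rw [Finset.sum_congr rfl h4, Finset.sum_congr rfl h5]
  simp only [smul_eq_C_mul, map_mul, map_sub, map_one, map_natCast]
  ring

/-- the coefficients of `Z` on the formal module -/
def zco (N : ℕ) (a b : ℕ) (f : SymA) : SymA := if a < b then perpN (b - a) f else pN N (a - b) * f

theorem Zop_formula' {N n : ℕ} (i : Fin N) {m : ℕ} (h1 : 1 ≤ m) (h2 : m ≤ n) {f : SymA} (hf : f ∈ Lam (n - m)) :
    Zop alpha i (X i ^ m * evalN N f) =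
      ((alpha - 1) * m) • (X i ^ m * evalN N f)
      + ∑ b ∈ Finset.Icc 1 n, X i ^ b * evalN N (zco N m b f) := by
  rw [Zop_formula i m hf, add_assoc]
  congr 1
  have hs : Finset.Icc 1 n = Finset.Icc (m+1) n ∪ Finset.Icc 1 m := by
    ext x; simp only [Finset.mem_union, Finset.mem_Icc]; omega
  have hd : Disjoint (Finset.Icc (m+1) n) (Finset.Icc 1 m) := by
    rw [Finset.disjoint_left]; intro x; simp only [Finset.mem_Icc]; omega
  rw [hs, Finset.sum_union hd]
  congr 1
  · refine Finset.sum_bij (fun k _ => m + k) ?_ ?_ ?_ ?_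
    · intro k; simp only [Finset.mem_Icc]; omega
    · intro k _ l _; omega
    · intro b hb; simp only [Finset.mem_Icc] at hb
      exact ⟨b - m, by simp only [Finset.mem_Icc]; omega, by omega⟩
    · intro k hk; simp only [Finset.mem_Icc] at hk
      rw [zco, if_pos (by omega)]
      congr 4; omega
  · refine Finset.sum_bij (fun k _ => k + 1) ?_ ?_ ?_ ?_
    · intro k; simp only [Finset.mem_Icc, Finset.mem_range]; omega
    · intro k _ l _; omega
    · intro b hb; simp only [Finset.mem_Icc] at hb
      exact ⟨b - 1, by simp only [Finset.mem_range]; omega, by omega⟩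
    · intro k hk; simp only [Finset.mem_range] at hk
      rw [zco, if_neg (by omega)]
      congr 4; omega

theorem Zop_evalN {N n : ℕ} (i : Fin N) {f : SymA} (hf : f ∈ Lam n) :
    Zop alpha i (evalN N f) = ∑ b ∈ Finset.Icc 1 n, X i ^ b * evalN N (perpN b f) := by
  have := Zop_formula (N := N) i 0 hf
  simpa using this

theorem zco_mem_Lam {N n a b : ℕ} {f : SymA} (ha : a ≤ n) (hb : b ≤ n) (hf : f ∈ Lam (n - a)) :
    zco N a b f ∈ Lam (n - b) := by
  unfold zco
  split_ifs with h
  · apply perp_mem_Lam _ hf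
    rw [coe_toPNat' (by omega)]; omega
  · unfold pN
    split_ifs with h2
    · have : a = b := by omega
      subst this
      rw [← smul_eq_C_mul]; exact Submodule.smul_mem _ _ hf
    · have := X_mul_mem_Lam (a - b).toPNat' hf
      rw [coe_toPNat' h2] at this
      have e : a - b + (n - a) = n - b := by omega
      rwa [e] at this

theorem perpN_mem_Lam {n b : ℕ} {f : SymA} (h1 : 1 ≤ b) (hb : b ≤ n) (hf : f ∈ Lam n) :
    perpN b f ∈ Lam (n - b) := by
  apply perp_mem_Lam _ hf
  rw [coe_toPNat' (by omega)]; omega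

theorem zco_mem_Lq {N a b : ℕ} {f : SymA} (hf : f ∈ Lq) : zco N a b f ∈ Lq := by
  unfold zco pN
  split_ifs with h
  · exact perp_mem_Lq _ hf
  · rw [← smul_eq_C_mul]; exact smul_mem_Lq (natCast_mem _ _) hf
  · exact X_mul_mem_Lq _ hf

/-! ### The formal operators -/

def Zf (N n : ℕ) (v : ℕ → SymA) : ℕ → SymA := fun b =>
  ((alpha - 1) * b) • v b + ∑ a ∈ Finset.Icc 1 n, zco N a b (v a)

def inV (n : ℕ) (v : ℕ → SymA) : Prop := ∀ b ∈ Finset.Icc 1 n, v b ∈ Lam (n - b)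

theorem inV_Zf {N n : ℕ} {v : ℕ → SymA} (hv : inV n v) : inV n (Zf N n v) := by
  intro b hb
  refine Submodule.add_mem _ (Submodule.smul_mem _ _ (hv b hb)) (Submodule.sum_mem _ fun a ha => ?_)
  exact zco_mem_Lam (Finset.mem_Icc.1 ha).2 (Finset.mem_Icc.1 hb).2 (hv a ha)

theorem inV_Zf_iterate {N n : ℕ} {v : ℕ → SymA} (hv : inV n v) (k : ℕ) : inV n ((Zf N n)^[k] v) := by
  induction k with
  | zero => exact hv
  | succ k ih => rw [Function.iterate_succ_apply']; exact inV_Zf ih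

def EV (N n : ℕ) (i : Fin N) (v : ℕ → SymA) : MvPolynomial (Fin N) F :=
  ∑ b ∈ Finset.Icc 1 n, X i ^ b * evalN N (v b)

theorem Zop_EV {N n : ℕ} (i : Fin N) {v : ℕ → SymA} (hv : inV n v) :
    Zop alpha i (EV N n i v) = EV N n i (Zf N n v) := by
  unfold EV Zf
  rw [map_sum]
  have h1 : ∀ b ∈ Finset.Icc 1 n, Zop alpha i (X i ^ b * evalN N (v b)) = 
      ((alpha - 1) * b) • (X i ^ b * evalN N (v b))
      + ∑ c ∈ Finset.Icc 1 n, X i ^ c * evalN N (zco N b c (v b)) := by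
    intro b hb
    exact Zop_formula' i (Finset.mem_Icc.1 hb).1 (Finset.mem_Icc.1 hb).2 (hv b hb)
  rw [Finset.sum_congr rfl h1, Finset.sum_add_distrib, Finset.sum_comm, ← Finset.sum_add_distrib]
  refine Finset.sum_congr rfl fun b _ => ?_
  rw [map_add, map_smul, mul_add, mul_smul_comm, map_sum, Finset.mul_sum]

theorem Zop_EV_iterate {N n : ℕ} (i : Fin N) {v : ℕ → SymA} (hv : inV n v) (k : ℕ) :
    (Zop alpha i ^ k) (EV N n i v) = EV N n i ((Zf N n)^[k] v) := by
  induction k with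
  | zero => simp
  | succ k ih =>
    rw [pow_succ', Module.End.mul_apply, ih, Function.iterate_succ_apply', Zop_EV i (inV_Zf_iterate hv k)]

theorem hall_zco (N a b : ℕ) (f g : SymA) : hall (zco N a b f) g = hall f (zco N b a g) := by
  unfold zco
  rcases lt_trichotomy a b with h | rfl | h
  · rw [if_pos h, if_neg (by omega), pN, if_neg (by omega), hall_mul_X]; rfl
  · simp only [lt_irrefl, if_false, pN, Nat.sub_self, if_true, ← smul_eq_C_mul]
    rw [hall_smul_left, hall_smul_right]
  · rw [if_neg (by omega), if_pos h, pN, if_neg (by omega), hall_X_mul]; rfl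

def hallV (n : ℕ) (v w : ℕ → SymA) : F := ∑ b ∈ Finset.Icc 1 n, hall (v b) (w b)

theorem hallV_Zf (N n : ℕ) (v w : ℕ → SymA) : hallV n (Zf N n v) w = hallV n v (Zf N n w) := by
  unfold hallV Zf
  simp only [hall_add_left, hall_add_right, hall_smul_left, hall_smul_right, hall_sum_left, hall_sum_right,
    Finset.sum_add_distrib]
  congr 1
  rw [Finset.sum_comm]
  refine Finset.sum_congr rfl fun a _ => Finset.sum_congr rfl fun b _ => hall_zco N a b _ _

theorem hallV_Zf_iterate (N n k : ℕ) (v w : ℕ → SymA) :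
    hallV n ((Zf N n)^[k] v) w = hallV n v ((Zf N n)^[k] w) := by
  induction k generalizing v w with
  | zero => rfl
  | succ k ih => rw [Function.iterate_succ_apply, ih, hallV_Zf, Function.iterate_succ_apply']

/-- `T f` -/
def Tf (f : SymA) : ℕ → SymA := fun b => perpN b f

theorem inV_Tf {n : ℕ} {f : SymA} (hf : f ∈ Lam n) : inV n (Tf f) := by
  intro b hb
  exact perpN_mem_Lam (Finset.mem_Icc.1 hb).1 (Finset.mem_Icc.1 hb).2 hf

theorem Zop_evalN' {N n : ℕ} (i : Fin N) {f : SymA} (hf : f ∈ Lam n) :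
    Zop alpha i (evalN N f) = EV N n i (Tf f) := Zop_evalN i hf

/-- commuting Hamiltonians (before knowing that they commute); realises `∑ Z_l^(k+1)` -/
def Hf (N n k : ℕ) (f : SymA) : SymA :=
  ∑ b ∈ Finset.Icc 1 n, pN N b * (Zf N n)^[k] (Tf f) b

theorem Hf_mem {N n k : ℕ} {f : SymA} (hf : f ∈ Lam n) : Hf N n k f ∈ Lam n := by
  refine Submodule.sum_mem _ fun b hb => ?_
  have h1 := inV_Zf_iterate (N := N) (inV_Tf hf) k b hb
  obtain ⟨hb1, hb2⟩ := Finset.mem_Icc.1 hb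
  rw [pN, if_neg (by omega)]
  have := X_mul_mem_Lam b.toPNat' h1
  rw [coe_toPNat' (by omega)] at this
  have e : b + (n - b) = n := by omega
  rwa [e] at this

theorem hall_Hf (N n k : ℕ) (f g : SymA) : hall (Hf N n k f) g = hall f (Hf N n k g) := by
  have h1 : ∀ f g, hall (Hf N n k f) g = hallV n ((Zf N n)^[k] (Tf f)) (Tf g) := by
    intro f g
    unfold Hf hallV Tf
    rw [hall_sum_left]
    refine Finset.sum_congr rfl fun b hb => ?_
    obtain ⟨hb1, hb2⟩ := Finset.mem_Icc.1 hb
    rw [pN, if_neg (by omega), hall_X_mul]; rfl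
  rw [h1, hall_symm f, h1, hallV_Zf_iterate]
  unfold hallV
  exact Finset.sum_congr rfl fun b _ => hall_symm _ _

theorem evalN_Hf {N n k : ℕ} {f : SymA} (hf : f ∈ Lam n) :
    evalN N (Hf N n k f) = ∑ i : Fin N, (Zop alpha i ^ (k+1)) (evalN N f) := by
  have h1 : ∀ i : Fin N, (Zop alpha i ^ (k+1)) (evalN N f) = EV N n i ((Zf N n)^[k] (Tf f)) := by
    intro i
    rw [pow_succ, Module.End.mul_apply, Zop_evalN' i hf, Zop_EV_iterate i (inV_Tf hf)]
  simp only [h1]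
  unfold Hf EV
  rw [map_sum, Finset.sum_comm]
  refine Finset.sum_congr rfl fun b _ => ?_
  rw [map_mul, evalN_pN, Finset.sum_mul]

/-! ### Injectivity of evaluation -/

def kill0 (M : ℕ) : MvPolynomial (Fin (M+1)) F →ₐ[F] MvPolynomial (Fin M) F :=
  aeval (Fin.cases 0 X)

theorem kill0_evalN (M : ℕ) (f : SymA) : kill0 M (evalN (M+1) f) = evalN M f := by
  have : (kill0 M).comp (evalN (M+1)) = evalN M := by
    apply MvPolynomial.algHom_ext
    intro k
    rw [AlgHom.comp_apply, evalN_X, evalN_X, map_sum, Fin.sum_univ_succ]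
    simp [kill0]
  exact DFunLike.congr_fun this f

theorem wt_eq_zero {m : Exp} (h : wt m = 0) : m = 0 := by
  ext k
  by_contra hc
  have := wt_ge m k hc
  have := k.pos
  omega

theorem exists_sub_single {n : ℕ} (m : Exp) (hm : wt m = n) (hn : n ≠ 0) :
    ∃ b ∈ Finset.Icc 1 n, ∃ m', m = m' + Finsupp.single b.toPNat' 1 := by
  have : m ≠ 0 := by rintro rfl; simp at hm; omega
  obtain ⟨k, hk⟩ := Finsupp.ne_iff.1 this
  refine ⟨k, Finset.mem_Icc.2 ⟨k.pos, hm ▸ wt_ge m k hk⟩, m - Finsupp.single k 1, ?_⟩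
  rw [toPNat'_coe]
  ext i
  rcases eq_or_ne k i with rfl | hi
  · have : m k ≠ 0 := hk
    simp; omega
  · simp [hi]

theorem eq_zero_of_perpN {n : ℕ} (hn : n ≠ 0) {f : SymA} (hf : f ∈ Lam n)
    (h : ∀ b ∈ Finset.Icc 1 n, perpN b f = 0) : f = 0 := by
  apply eq_of_tc
  intro m
  by_cases hm : wt m = n
  · obtain ⟨b, hb, m', rfl⟩ := exists_sub_single m hm hn
    rw [← tc_perp]
    have := h b hb
    rw [perpN] at this
    rw [this]; simp [tc]
  · rw [tc, hf m hm]; simp [tc]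

theorem mem_Lq_of_perpN {n : ℕ} (hn : n ≠ 0) {f : SymA} (hf : f ∈ Lam n)
    (h : ∀ b ∈ Finset.Icc 1 n, perpN b f ∈ Lq) : f ∈ Lq := by
  intro m
  by_cases hm : wt m = n
  · obtain ⟨b, hb, m', rfl⟩ := exists_sub_single m hm hn
    rw [← tc_perp]
    exact h b hb m'
  · rw [tc, hf m hm, zero_mul]; exact ZA.zero_mem

def Inj (N : ℕ) : Prop := ∀ n ≤ N, ∀ f ∈ Lam n, evalN N f = 0 → f = 0

theorem EV_eq_zero_aux {M n : ℕ} (hI : Inj M) (hn : n ≤ M + 1) {v : ℕ → SymA} (hv : inV n v)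
    (h : EV (M+1) n 0 v = 0) (k : ℕ) : k ∈ Finset.Icc 1 n → v k = 0 := by
  induction k using Nat.strong_induction_on with
  | _ k ih =>
    intro hk
    obtain ⟨hk1, hk2⟩ := Finset.mem_Icc.1 hk
    have h1 : EV (M+1) n 0 v = X 0 ^ k * ∑ b ∈ Finset.Icc k n, X 0 ^ (b - k) * evalN (M+1) (v b) := by
      unfold EV
      rw [Finset.mul_sum]
      symm
      apply Finset.sum_subset_zero_on_sdiff
      · exact Finset.Icc_subset_Icc_left hk1
      · intro b hb
        simp only [Finset.mem_sdiff, Finset.mem_Icc] at hb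
        rw [ih b (by omega) (Finset.mem_Icc.2 (by omega)), map_zero, mul_zero]
      · intro b hb
        simp only [Finset.mem_Icc] at hb
        rw [← mul_assoc, ← pow_add]; congr 2; omega
    rw [h1, mul_eq_zero] at h
    have h2 := h.resolve_left (pow_ne_zero _ (X_ne_zero _))
    have h3 := congrArg (kill0 M) h2
    rw [map_sum, map_zero, Finset.sum_eq_single k] at h3
    · simp only [Nat.sub_self, pow_zero, one_mul, kill0_evalN] at h3
      exact hI (n - k) (by omega) _ (hv k hk) h3
    · intro b hb hbk
      simp only [Finset.mem_Icc] at hb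
      have : b - k ≠ 0 := by omega
      simp [kill0, this]
    · intro hc
      exact absurd (Finset.mem_Icc.2 ⟨le_refl _, hk2⟩) hc

theorem Inj_all (N : ℕ) : Inj N := by
  have h0 : ∀ N, ∀ f ∈ Lam 0, evalN N f = 0 → f = 0 := by
    intro N f hf h
    have h1 : f = C (coeff 0 f) := by
      ext m
      rw [coeff_C]
      split_ifs with hm
      · rw [← hm]
      · apply hf
        intro hc
        exact hm (wt_eq_zero hc).symm
    rw [h1, ← algebraMap_eq, AlgHom.commutes, algebraMap_eq, C_eq_zero] at h
    rw [h1, h, C_0]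
  induction N with
  | zero =>
    intro n hn
    obtain rfl : n = 0 := by omega
    exact h0 0
  | succ M ih =>
    intro n hn f hf h
    rcases Nat.eq_zero_or_pos n with rfl | hpos
    · exact h0 _ f hf h
    · apply eq_zero_of_perpN (by omega) hf
      have h1 := Zop_evalN' (0 : Fin (M+1)) hf
      rw [h, map_zero] at h1
      exact EV_eq_zero_aux ih hn (inV_Tf hf) h1.symm

theorem EV_eq_zero {M n : ℕ} (hn : n ≤ M + 1) {v : ℕ → SymA} (hv : inV n v)
    (h : EV (M+1) n 0 v = 0) : ∀ k ∈ Finset.Icc 1 n, v k = 0 :=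
  EV_eq_zero_aux (Inj_all M) hn hv h

theorem evalN_inj {N n : ℕ} (hn : n ≤ N) {f g : SymA} (hf : f ∈ Lam n) (hg : g ∈ Lam n)
    (h : evalN N f = evalN N g) : f = g := by
  rw [← sub_eq_zero]
  apply Inj_all N n hn _ (Submodule.sub_mem _ hf hg)
  rw [map_sub, h, sub_self]

/-! ### Partitions -/

theorem toExp_apply (l : JPartition) (i : ℕ+) : toExp l i = l.count i := by
  unfold toExp
  rw [Finsupp.finsetSum_apply]
  simp only [Finsupp.single_apply]
  rw [Finset.sum_ite_eq']
  split_ifs with h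
  · rfl
  · rw [Multiset.mem_toFinset] at h
    exact (Multiset.count_eq_zero.2 h).symm

theorem toExp_eq (l : JPartition) : toExp l = Multiset.toFinsupp l := by
  ext i
  rw [toExp_apply, Multiset.toFinsupp_apply]

theorem toExp_injective : Function.Injective toExp := by
  intro a b h
  rw [toExp_eq, toExp_eq] at h
  exact Multiset.toFinsupp.injective h

theorem toExp_surjective : Function.Surjective toExp := by
  intro m
  obtain ⟨l, hl⟩ := Multiset.toFinsupp.surjective m
  exact ⟨l, by rw [toExp_eq, hl]⟩

theorem toExp_add (a b : JPartition) : toExp (a + b) = toExp a + toExp b := by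
  simp only [toExp_eq, map_add]

theorem wt_toExp (l : JPartition) : wt (toExp l) = psize l := by
  induction l using Multiset.induction_on with
  | empty => simp [toExp, psize]
  | cons k s ih =>
    rw [← Multiset.singleton_add, toExp_add, wt_add, ih, toExp_eq, Multiset.toFinsupp_singleton, wt_single]
    simp [psize]

theorem psize_eq (l : JPartition) : psize l = (l.map PNat.val).sum := by
  simp only [psize, Multiset.map_id', Multiset.bind_def, Multiset.pure_def, Multiset.bind_singleton]

theorem sortedParts_eq (l : JPartition) : sortedParts l = ((l.map PNat.val).sort (· ≤ ·)).reverse := by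
  simp only [sortedParts, Multiset.map_id', Multiset.bind_def, Multiset.pure_def,
    Multiset.bind_singleton]

theorem plen_le_psize (l : JPartition) : plen l ≤ psize l := by
  induction l using Multiset.induction_on with
  | empty => simp [plen, psize]
  | cons k s ih =>
    simp only [plen, psize_eq, Multiset.card_cons, Multiset.map_cons, Multiset.sum_cons] at *
    have := k.pos
    have h2 : PNat.val k = (k : ℕ) := rfl
    omega

abbrev Pt (n : ℕ) : Type := {l : JPartition // psize l = n}

instance Pt_finite (n : ℕ) : Finite (Pt n) := by
  let φ : Pt n → Nat.Partition n := fun l =>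
    ⟨l.1.map PNat.val, by
      intro i hi
      obtain ⟨k, _, rfl⟩ := Multiset.mem_map.1 hi
      exact k.pos, (psize_eq _).symm.trans l.2⟩
  apply Finite.of_injective φ
  intro a b h
  have h1 : a.1.map PNat.val = b.1.map PNat.val := congrArg Nat.Partition.parts h
  exact Subtype.ext (Multiset.map_injective PNat.coe_injective h1)

instance Pt_fintype (n : ℕ) : Fintype (Pt n) := Fintype.ofFinite _

theorem Lam_sum {n : ℕ} {f : SymA} (hf : f ∈ Lam n) :
    f = ∑ l : Pt n, monomial (toExp l.1) (coeff (toExp l.1) f) := by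
  ext m
  rw [coeff_sum]
  simp only [coeff_monomial]
  by_cases hm : wt m = n
  · obtain ⟨l, rfl⟩ := toExp_surjective m
    rw [wt_toExp] at hm
    rw [Finset.sum_eq_single ⟨l, hm⟩]
    · simp
    · intro b _ hb
      rw [if_neg]
      intro hc
      exact hb (Subtype.ext (toExp_injective hc))
    · simp
  · rw [hf m hm, Finset.sum_eq_zero]
    intro l _
    rw [if_neg]
    rintro rfl
    exact hm ((wt_toExp _).trans l.2)

theorem Lam_sum_qq {n : ℕ} {f : SymA} (hf : f ∈ Lam n) :
    f = ∑ l : Pt n, tc (toExp l.1) f • qq (toExp l.1) := by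
  conv_lhs => rw [Lam_sum hf]
  refine Finset.sum_congr rfl fun l _ => ?_
  rw [qq, smul_monomial, tc, smul_eq_mul, mul_assoc, mul_inv_cancel₀ (zalpha_ne_zero _), mul_one]

theorem hall_Lam {n : ℕ} {f : SymA} (hf : f ∈ Lam n) (g : SymA) :
    hall f g = ∑ l : Pt n, coeff (toExp l.1) f * tc (toExp l.1) g := by
  conv_lhs => rw [Lam_sum hf, hall_sum_left]
  exact Finset.sum_congr rfl fun l _ => hall_monomial_left _ _ _

/-! ### Dominance via truncated sums -/

def ppl (l : JPartition) (t : ℕ) : ℕ := (l.map (fun i : ℕ+ => i.val - t)).sum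

theorem ppl_add (a b : JPartition) (t : ℕ) : ppl (a + b) t = ppl a t + ppl b t := by
  simp [ppl]

theorem ppl_zero (t : ℕ) : ppl 0 t = 0 := by simp [ppl]

theorem ppl_sum {ι : Type*} (s : Finset ι) (f : ι → JPartition) (t : ℕ) :
    ppl (∑ i ∈ s, f i) t = ∑ i ∈ s, ppl (f i) t := by
  induction s using Finset.induction_on with
  | empty => simp [ppl_zero]
  | insert a s ha ih => rw [Finset.sum_insert ha, Finset.sum_insert ha, ppl_add, ih]

theorem psize_ppl (l : JPartition) : psize l = ppl l 0 := by
  rw [psize_eq, ppl]; simp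

theorem ppl_count (l : JPartition) (v : ℕ+) :
    ppl l (v.val - 1) + ppl l (v.val + 1) = l.count v + 2 * ppl l v.val := by
  induction l using Multiset.induction_on with
  | empty => simp [ppl]
  | cons k s ih =>
    simp only [ppl, Multiset.map_cons, Multiset.sum_cons] at *
    have hv := v.pos
    have hk := k.pos
    have e1 : PNat.val v = (v : ℕ) := rfl
    have e2 : PNat.val k = (k : ℕ) := rfl
    rw [Multiset.count_cons]
    by_cases h : v = k
    · subst h; simp only [if_true]; omega
    · rw [if_neg h]
      have : (v : ℕ) ≠ k := fun h' => h (PNat.coe_injective h')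
      omega

def Domp (m l : JPartition) : Prop := psize m = psize l ∧ ∀ t, ppl m t ≤ ppl l t

theorem Domp.refl (l : JPartition) : Domp l l := ⟨rfl, fun _ => le_rfl⟩

theorem Domp.trans {a b c : JPartition} (h : Domp a b) (h' : Domp b c) : Domp a c :=
  ⟨h.1.trans h'.1, fun t => (h.2 t).trans (h'.2 t)⟩

theorem Domp.antisymm {a b : JPartition} (h : Domp a b) (h' : Domp b a) : a = b := by
  have e : ∀ t, ppl a t = ppl b t := fun t => le_antisymm (h.2 t) (h'.2 t)
  ext v
  have h1 := ppl_count a v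
  have h2 := ppl_count b v
  rw [e, e, e] at h1
  omega

theorem list_fact1 (L : List ℕ) (t k : ℕ) : (L.take k).sum ≤ (L.map (fun i => i - t)).sum + k * t := by
  induction L generalizing k with
  | nil => simp
  | cons a L ih =>
    cases k with
    | zero => simp
    | succ k =>
      have := ih k
      simp only [List.take_succ_cons, List.sum_cons, List.map_cons, add_mul, one_mul]
      omega

theorem list_fact2 (L : List ℕ) (hL : L.Pairwise (· ≥ ·)) (t : ℕ) :
    ∃ k, (L.map (fun i => i - t)).sum + k * t = (L.take k).sum := by
  induction L with
  | nil => exact ⟨0, by simp⟩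
  | cons a L ih =>
    rw [List.pairwise_cons] at hL
    by_cases h : t < a
    · obtain ⟨k, hk⟩ := ih hL.2
      refine ⟨k + 1, ?_⟩
      simp only [List.take_succ_cons, List.sum_cons, List.map_cons, add_mul, one_mul]
      omega
    · refine ⟨0, ?_⟩
      simp only [List.take_zero, List.sum_nil, zero_mul, add_zero]
      apply List.sum_eq_zero
      intro x hx
      obtain ⟨y, hy, rfl⟩ := List.mem_map.1 hx
      rcases List.mem_cons.1 hy with rfl | hy
      · omega
      · have := hL.1 y hy
        omega

theorem sortedParts_coe (l : JPartition) : ((sortedParts l : List ℕ) : Multiset ℕ) = l.map PNat.val := by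
  rw [sortedParts_eq, Multiset.coe_reverse, Multiset.sort_eq]

theorem sortedParts_sorted (l : JPartition) : (sortedParts l).Pairwise (· ≥ ·) := by
  rw [sortedParts_eq, List.pairwise_reverse]
  exact Multiset.pairwise_sort _ _

theorem ppl_sortedParts (l : JPartition) (t : ℕ) :
    ppl l t = ((sortedParts l).map (fun i => i - t)).sum := by
  rw [← Multiset.sum_coe, ← Multiset.map_coe, sortedParts_coe, Multiset.map_map]
  rfl

theorem Domp_of_dominates {m l : JPartition} (h : dominates m l) : Domp m l := by
  refine ⟨h.1, fun t => ?_⟩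
  obtain ⟨k, hk⟩ := list_fact2 _ (sortedParts_sorted m) t
  have h1 := list_fact1 (sortedParts l) t k
  have h2 := h.2 k
  rw [topSum, topSum] at h2
  rw [ppl_sortedParts, ppl_sortedParts]
  omega

/-! ### The partition of an exponent -/

def pone (n : ℕ) : JPartition := if n = 0 then 0 else {n.toPNat'}

theorem ppl_pone (n t : ℕ) : ppl (pone n) t = n - t := by
  rw [pone]
  split_ifs with h
  · subst h; simp [ppl]
  · simp only [ppl, Multiset.map_singleton, Multiset.sum_singleton]
    have : PNat.val n.toPNat' = n := coe_toPNat' (by omega)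
    rw [this]

theorem pone_coe (i : ℕ+) : pone i.val = {i} := by
  rw [pone, if_neg i.pos.ne', toPNat'_coe]

theorem pone_map (n : ℕ) : (pone n).map PNat.val + (if n = 0 then {0} else 0) = {n} := by
  rw [pone]
  split_ifs with h
  · subst h; simp
  · have : PNat.val n.toPNat' = n := coe_toPNat' (by omega)
    simp [this]

def partOf {N : ℕ} (κ : Fin N →₀ ℕ) : JPartition := ∑ i, pone (κ i)

theorem ppl_partOf {N : ℕ} (κ : Fin N →₀ ℕ) (t : ℕ) : ppl (partOf κ) t = ∑ i, (κ i - t) := by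
  rw [partOf, ppl_sum]
  exact Finset.sum_congr rfl fun i _ => ppl_pone _ _

theorem psize_partOf {N : ℕ} (κ : Fin N →₀ ℕ) : psize (partOf κ) = ∑ i, κ i := by
  rw [psize_ppl, ppl_partOf]; simp

theorem full_eq {N : ℕ} (κ : Fin N →₀ ℕ) :
    (Finset.univ : Finset (Fin N)).val.map κ =
      (partOf κ).map PNat.val + Multiset.replicate (N - Multiset.card (partOf κ)) 0 := by
  have h1 : (Finset.univ : Finset (Fin N)).val.map κ = ∑ i, ({κ i} : Multiset ℕ) := by
    rw [Finset.sum]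
    rw [← Multiset.sum_map_singleton ((Finset.univ : Finset (Fin N)).val.map κ), Multiset.map_map]
    rfl
  have h2 : ∑ i, ({κ i} : Multiset ℕ) = (partOf κ).map PNat.val +
      ∑ i, (if κ i = 0 then ({0} : Multiset ℕ) else 0) := by
    rw [partOf, ← Multiset.coe_mapAddMonoidHom, map_sum, ← Finset.sum_add_distrib]
    exact Finset.sum_congr rfl fun i _ => (pone_map _).symm
  have h3 : ∃ c, ∑ i, (if κ i = 0 then ({0} : Multiset ℕ) else 0) = Multiset.replicate c 0 := by
    refine ⟨_, Multiset.eq_replicate_card.2 ?_⟩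
    intro b hb
    obtain ⟨i, _, hi⟩ := Multiset.mem_sum.1 hb
    split_ifs at hi
    · simpa using hi
    · simp at hi
  obtain ⟨c, hc⟩ := h3
  have h4 := congrArg Multiset.card (h1.trans h2)
  rw [hc] at h4
  simp at h4
  rw [h1, h2, hc]
  congr 2
  omega

theorem exists_perm_of_partOf {N : ℕ} {κ κ' : Fin N →₀ ℕ} (h : partOf κ = partOf κ') :
    ∃ σ : Equiv.Perm (Fin N), ∀ i, κ i = κ' (σ i) := by
  have h1 := full_eq κ
  rw [h, ← full_eq κ'] at h1
  have h2 : ∀ c, Nonempty ({ a // κ a = c } ≃ { b // κ' b = c }) := by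
    intro c
    refine Fintype.card_eq.1 ?_
    have h3 := congrArg (Multiset.count c) h1
    rw [Multiset.count_map, Multiset.count_map] at h3
    rw [Fintype.card_subtype, Fintype.card_subtype, Finset.card, Finset.card, Finset.filter_val,
      Finset.filter_val]
    simpa only [eq_comm] using h3
  refine ⟨Equiv.ofFiberEquiv fun c => (h2 c).some, fun i => ?_⟩
  exact (Equiv.ofFiberEquiv_map (fun c => (h2 c).some) i).symm

theorem partOf_castAdd {N N' : ℕ} (κ : Fin N →₀ ℕ) :
    partOf (κ.mapDomain (Fin.castAdd N')) = partOf κ := by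
  rw [partOf, Fin.sum_univ_add, partOf]
  conv_rhs => rw [← add_zero (∑ i, pone (κ i))]
  congr 1
  · refine Finset.sum_congr rfl fun i _ => ?_
    rw [Finsupp.mapDomain_apply (Fin.castAdd_injective _ _)]
  · refine Finset.sum_eq_zero fun i _ => ?_
    rw [Finsupp.mapDomain_of_notMem_range]
    · simp [pone]
    · rintro ⟨j, hj⟩
      have := congrArg Fin.val hj
      simp at this
      omega

theorem partOf_natAdd {N N' : ℕ} (κ : Fin N →₀ ℕ) :
    partOf (κ.mapDomain (Fin.natAdd N')) = partOf κ := by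
  rw [partOf, Fin.sum_univ_add, partOf]
  conv_rhs => rw [← zero_add (∑ i, pone (κ i))]
  congr 1
  · refine Finset.sum_eq_zero fun i _ => ?_
    rw [Finsupp.mapDomain_of_notMem_range]
    · simp [pone]
    · rintro ⟨j, hj⟩
      have := congrArg Fin.val hj
      simp at this
      omega
  · refine Finset.sum_congr rfl fun i _ => ?_
    rw [Finsupp.mapDomain_apply (Fin.natAdd_injective _ _)]

theorem sum_getD (L : List ℕ) (N : ℕ) (h : L.length ≤ N) :
    ∑ j ∈ Finset.range N, pone (L.getD j 0) = (L.map pone).sum := by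
  induction L generalizing N with
  | nil => simp [pone]
  | cons a L ih =>
    obtain _ | N := N
    · simp at h
    · rw [Finset.sum_range_succ']
      simp only [List.getD_cons_succ, List.getD_cons_zero, List.map_cons, List.sum_cons]
      rw [ih N (by simpa using h), add_comm]

theorem partOf_xexp (m : JPartition) (N : ℕ) (h : plen m ≤ N) : partOf (xexp m N) = m := by
  have hlen : (sortedParts m).length = plen m := by
    rw [← Multiset.coe_card, sortedParts_coe, Multiset.card_map, plen]
  have : partOf (xexp m N) = ∑ j : Fin N, pone ((sortedParts m).getD (j : ℕ) 0) := rfl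
  rw [this, Fin.sum_univ_eq_sum_range (fun j => pone ((sortedParts m).getD j 0)),
    sum_getD _ _ (by omega), ← Multiset.sum_coe, ← Multiset.map_coe, sortedParts_coe,
    Multiset.map_map]
  have h2 : (pone ∘ PNat.val) = fun i : ℕ+ => ({i} : Multiset ℕ+) := funext pone_coe
  rw [h2, Multiset.sum_map_singleton]

theorem killCompl_evalN {N M : ℕ} {φ : Fin N → Fin M} (hφ : Function.Injective φ) (f : SymA) :
    killCompl hφ (evalN M f) = evalN N f := by
  have : (killCompl hφ).comp (evalN M) = evalN N := by
    apply MvPolynomial.algHom_ext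
    intro k
    rw [AlgHom.comp_apply, evalN_X, evalN_X, map_sum]
    simp only [map_pow]
    have h1 : ∀ j, j ∉ Finset.univ.map ⟨φ, hφ⟩ → (killCompl hφ (X j : MvPolynomial (Fin M) F)) ^ (k : ℕ) = 0 := by
      intro j hj
      rw [killCompl, aeval_X, dif_neg, zero_pow k.pos.ne']
      simpa using hj
    rw [← Finset.sum_subset (Finset.subset_univ (Finset.univ.map ⟨φ, hφ⟩)) (fun j _ hj => h1 j hj),
      Finset.sum_map]
    refine Finset.sum_congr rfl fun i _ => ?_
    have h2 := killCompl_rename_app hφ (X i : MvPolynomial (Fin N) F)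
    rw [rename_X] at h2
    change (killCompl hφ (X (φ i))) ^ _ = _
    rw [h2]
  exact DFunLike.congr_fun this f

theorem coeff_perm {N : ℕ} {v : MvPolynomial (Fin N) F} (hv : ∀ σ, Sg F σ v = v)
    {κ κ' : Fin N →₀ ℕ} (h : partOf κ = partOf κ') : coeff κ v = coeff κ' v := by
  obtain ⟨σ, hσ⟩ := exists_perm_of_partOf h
  have h1 : κ' = κ.mapDomain σ := by
    ext i
    have := hσ (σ.symm i)
    rw [Equiv.apply_symm_apply] at this
    rw [← this, ← Finsupp.equivMapDomain_eq_mapDomain, Finsupp.equivMapDomain_apply]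
  have h2 := hv σ
  rw [Sg_apply] at h2
  rw [h1, ← h2, coeff_rename_mapDomain _ σ.injective, h2]

theorem coeff_stab {N N' : ℕ} (f : SymA) {κ : Fin N →₀ ℕ} {κ' : Fin N' →₀ ℕ}
    (h : partOf κ = partOf κ') : coeff κ (evalN N f) = coeff κ' (evalN N' f) := by
  rw [← killCompl_evalN (Fin.castAdd_injective N N') f, coeff_killCompl,
    ← killCompl_evalN (Fin.natAdd_injective N' N) f, coeff_killCompl]
  apply coeff_perm
  · intro σ; exact Sg_evalN σ f
  · rw [partOf_castAdd, partOf_natAdd, h]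

/-! ### Triangular action on monomials -/

theorem Domp_move {N : ℕ} {κ κ' : Fin N →₀ ℕ} {i j : Fin N} (hij : i ≠ j)
    (h : ∀ l, l ≠ i → l ≠ j → κ' l = κ l) (hs : κ' i + κ' j = κ i + κ j)
    (ht : ∀ t, (κ' i - t) + (κ' j - t) ≤ (κ i - t) + (κ j - t)) :
    Domp (partOf κ') (partOf κ) := by
  have key : ∀ f : ℕ → ℕ, ∃ R, (∑ l, f (κ l) = f (κ i) + f (κ j) + R) ∧
      (∑ l, f (κ' l) = f (κ' i) + f (κ' j) + R) := by
    intro f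
    refine ⟨∑ l ∈ (Finset.univ.erase i).erase j, f (κ l), ?_, ?_⟩
    · rw [add_assoc, Finset.add_sum_erase _ (fun l => f (κ l)) (by simp [hij.symm]),
        Finset.add_sum_erase _ (fun l => f (κ l)) (by simp)]
    · have : ∑ l ∈ (Finset.univ.erase i).erase j, f (κ l) =
          ∑ l ∈ (Finset.univ.erase i).erase j, f (κ' l) := by
        refine Finset.sum_congr rfl fun l hl => ?_
        simp only [Finset.mem_erase, Finset.mem_univ, and_true] at hl
        rw [h l hl.2 hl.1]
      rw [this, add_assoc, Finset.add_sum_erase _ (fun l => f (κ' l)) (by simp [hij.symm]),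
        Finset.add_sum_erase _ (fun l => f (κ' l)) (by simp)]
  constructor
  · rw [psize_partOf, psize_partOf]
    obtain ⟨R, h1, h2⟩ := key id
    simp only [id] at h1 h2
    omega
  · intro t
    rw [ppl_partOf, ppl_partOf]
    obtain ⟨R, h1, h2⟩ := key (fun x => x - t)
    have := ht t
    omega

def GG {N : ℕ} (κ : Fin N →₀ ℕ) : AddSubgroup (MvPolynomial (Fin N) F) :=
  AddSubgroup.closure {v | ∃ κ', Domp (partOf κ') (partOf κ) ∧ v = monomial κ' 1}

theorem GG_coeff {N : ℕ} {κ : Fin N →₀ ℕ} {v : MvPolynomial (Fin N) F} (hv : v ∈ GG κ)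
    (κ' : Fin N →₀ ℕ) : (∃ z : ℤ, coeff κ' v = z) ∧ (coeff κ' v ≠ 0 → Domp (partOf κ') (partOf κ)) := by
  induction hv using AddSubgroup.closure_induction with
  | mem x hx =>
    obtain ⟨κ1, h1, rfl⟩ := hx
    rw [coeff_monomial]
    split_ifs with h
    · subst h; exact ⟨⟨1, by simp⟩, fun _ => h1⟩
    · exact ⟨⟨0, by simp⟩, fun h => absurd rfl h⟩
  | zero => exact ⟨⟨0, by simp⟩, fun h => absurd (coeff_zero _) h⟩
  | add x y _ _ hx hy =>
    obtain ⟨⟨a, ha⟩, ha'⟩ := hx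
    obtain ⟨⟨b, hb⟩, hb'⟩ := hy
    rw [coeff_add]
    refine ⟨⟨a + b, by rw [ha, hb]; push_cast; ring⟩, fun h => ?_⟩
    by_cases hx0 : coeff κ' x = 0
    · rw [hx0, zero_add] at h; exact hb' h
    · exact ha' hx0
  | neg x _ hx =>
    obtain ⟨⟨a, ha⟩, ha'⟩ := hx
    rw [coeff_neg]
    exact ⟨⟨-a, by rw [ha]; push_cast; ring⟩, fun h => ha' (by simpa using h)⟩

def Good {N : ℕ} (T : Module.End F (MvPolynomial (Fin N) F)) : Prop :=
  ∀ κ, T (monomial κ 1) ∈ GG κ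

theorem Good.add {N : ℕ} {S T : Module.End F (MvPolynomial (Fin N) F)} (hS : Good S) (hT : Good T) :
    Good (S + T) := fun κ => by
  rw [LinearMap.add_apply]; exact AddSubgroup.add_mem _ (hS κ) (hT κ)

theorem Good.sum {N : ℕ} {ι : Type*} (s : Finset ι) {T : ι → Module.End F (MvPolynomial (Fin N) F)}
    (hT : ∀ i ∈ s, Good (T i)) : Good (∑ i ∈ s, T i) := fun κ => by
  rw [LinearMap.sum_apply]; exact AddSubgroup.sum_mem _ fun i hi => hT i hi κ

theorem Good_Sg {N : ℕ} (σ : Equiv.Perm (Fin N)) : Good (Sg F σ) := fun κ => by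
  rw [Sg_apply, rename_monomial]
  refine AddSubgroup.subset_closure ⟨_, ?_, rfl⟩
  have : partOf (κ.mapDomain σ) = partOf κ := by
    rw [partOf, partOf, ← Equiv.sum_comp σ]
    refine Finset.sum_congr rfl fun i _ => ?_
    rw [Finsupp.mapDomain_apply σ.injective]
  rw [this]; exact Domp.refl _

theorem Aop_pow' {N : ℕ} {i j : Fin N} (h : i ≠ j) (m : ℕ) :
    Aop F i j (X j ^ m) = - Aop F i j (X i ^ m) := by
  rw [← add_eq_zero_iff_eq_neg, ← map_add]
  apply Aop_eq h
  simp [add_comm]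

theorem Aop_mon {N : ℕ} {i j : Fin N} (h : i ≠ j) (m : ℕ) (ρ : Fin N →₀ ℕ) (hρ : ρ i = ρ j) :
    Aop F i j (monomial (Finsupp.single i m + ρ) 1) =
      ∑ c ∈ Finset.range m, monomial (Finsupp.single i (c + 1) + Finsupp.single j (m - 1 - c) + ρ) (1 : F) ∧
    Aop F i j (monomial (Finsupp.single j m + ρ) 1) =
      - ∑ c ∈ Finset.range m, monomial (Finsupp.single i (c + 1) + Finsupp.single j (m - 1 - c) + ρ) (1 : F) := by
  have e : ∀ a : Fin N, ∀ m, monomial (Finsupp.single a m + ρ) (1 : F) = X a ^ m * monomial ρ 1 := by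
    intro a m
    rw [X_pow_eq_monomial, monomial_mul, one_mul]
  have e2 : ∀ p q, monomial (Finsupp.single i p + Finsupp.single j q + ρ) (1 : F) =
      X i ^ p * X j ^ q * monomial ρ 1 := by
    intro p q
    rw [X_pow_eq_monomial, X_pow_eq_monomial, monomial_mul, monomial_mul]
    simp
  have hinv : rename (Equiv.swap i j) (monomial ρ (1 : F)) = monomial ρ 1 := by
    rw [rename_monomial]
    refine congrArg (fun x => monomial x (1 : F)) (Finsupp.ext fun l => ?_)
    rw [← Finsupp.equivMapDomain_eq_mapDomain, Finsupp.equivMapDomain_apply, Equiv.symm_swap]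
    rcases eq_or_ne l i with rfl | h1
    · rw [Equiv.swap_apply_left, hρ]
    rcases eq_or_ne l j with rfl | h2
    · rw [Equiv.swap_apply_right, hρ]
    rw [Equiv.swap_apply_of_ne_of_ne h1 h2]
  simp only [e, e2]
  rw [Aop_mul_inv _ _ _ _ hinv, Aop_mul_inv _ _ _ _ hinv, Aop_pow' h, Aop_pow h, Finset.sum_mul,
    neg_mul, Finset.sum_mul]
  exact ⟨rfl, rfl⟩

theorem Good_Aop {N : ℕ} (i j : Fin N) : Good (Aop F i j) := by
  rcases eq_or_ne i j with rfl | hij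
  · intro κ; rw [Aop_self, LinearMap.zero_apply]; exact AddSubgroup.zero_mem _
  intro κ
  rcases le_total (κ j) (κ i) with hle | hle
  · obtain ⟨ρ, hκ, hρ⟩ : ∃ ρ : Fin N →₀ ℕ, κ = Finsupp.single i (κ i - κ j) + ρ ∧ ρ i = ρ j := by
      refine ⟨κ - Finsupp.single i (κ i - κ j), ?_, ?_⟩
      · ext l
        rcases eq_or_ne i l with rfl | hl
        · simp
        · simp [hl]
      · simp [hij]; omega
    generalize hm : κ i - κ j = m at hκ
    rw [hκ, (Aop_mon hij m ρ hρ).1]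
    refine AddSubgroup.sum_mem _ fun c hc => AddSubgroup.subset_closure ⟨_, ?_, rfl⟩
    rw [Finset.mem_range] at hc
    apply Domp_move hij
    · intro l h1 h2; simp [h1.symm, h2.symm]
    · simp [hij, hij.symm]; omega
    · intro t; simp [hij, hij.symm]; omega
  · obtain ⟨ρ, hκ, hρ⟩ : ∃ ρ : Fin N →₀ ℕ, κ = Finsupp.single j (κ j - κ i) + ρ ∧ ρ i = ρ j := by
      refine ⟨κ - Finsupp.single j (κ j - κ i), ?_, ?_⟩
      · ext l
        rcases eq_or_ne j l with rfl | hl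
        · simp
        · simp [hl]
      · simp [hij]; omega
    generalize hm : κ j - κ i = m at hκ
    rw [hκ, (Aop_mon hij m ρ hρ).2]
    refine AddSubgroup.neg_mem _ <| AddSubgroup.sum_mem _ fun c hc =>
      AddSubgroup.subset_closure ⟨_, ?_, rfl⟩
    rw [Finset.mem_range] at hc
    apply Domp_move hij
    · intro l h1 h2; simp [h1.symm, h2.symm]
    · simp [hij, hij.symm]; omega
    · intro t; simp [hij, hij.symm]; omega

theorem apply_eq_sum {N : ℕ} (T : Module.End F (MvPolynomial (Fin N) F)) (v : MvPolynomial (Fin N) F)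
    (κ' : Fin N →₀ ℕ) :
    coeff κ' (T v) = ∑ κ ∈ v.support, coeff κ v * coeff κ' (T (monomial κ 1)) := by
  conv_lhs => rw [v.as_sum, map_sum, coeff_sum]
  refine Finset.sum_congr rfl fun κ _ => ?_
  have : monomial κ (coeff κ v) = coeff κ v • monomial κ (1 : F) := by rw [smul_monomial]; simp
  rw [this, map_smul, coeff_smul, smul_eq_mul]

def WW (N : ℕ) (l : JPartition) : Submodule F (MvPolynomial (Fin N) F) where
  carrier := {v | ∀ κ, coeff κ v ≠ 0 → Domp (partOf κ) l}
  zero_mem' := fun κ h => absurd (coeff_zero _) h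
  add_mem' := by
    intro x y hx hy κ h
    rw [coeff_add] at h
    by_cases hx0 : coeff κ x = 0
    · rw [hx0, zero_add] at h; exact hy κ h
    · exact hx κ hx0
  smul_mem' := by
    intro c x hx κ h
    rw [coeff_smul] at h
    exact hx κ (right_ne_zero_of_smul h)

theorem mem_WW {N : ℕ} {l : JPartition} {v : MvPolynomial (Fin N) F} :
    v ∈ WW N l ↔ ∀ κ, coeff κ v ≠ 0 → Domp (partOf κ) l := Iff.rfl

theorem Good.presWW {N : ℕ} {T : Module.End F (MvPolynomial (Fin N) F)} (hT : Good T) {l : JPartition}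
    {v : MvPolynomial (Fin N) F} (hv : v ∈ WW N l) : T v ∈ WW N l := by
  rw [mem_WW] at *
  intro κ' h
  rw [apply_eq_sum] at h
  obtain ⟨κ, _, hκ⟩ := Finset.exists_ne_zero_of_sum_ne_zero h
  exact ((GG_coeff (hT κ) κ').2 (right_ne_zero_of_mul hκ)).trans (hv κ (left_ne_zero_of_mul hκ))

def LD {N : ℕ} (D : AddSubgroup F) (l : JPartition) (v : MvPolynomial (Fin N) F) : Prop :=
  ∀ κ, partOf κ = l → coeff κ v ∈ D

theorem Good.presLD {N : ℕ} {T : Module.End F (MvPolynomial (Fin N) F)} (hT : Good T) {l : JPartition}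
    {v : MvPolynomial (Fin N) F} (hv : v ∈ WW N l) {D : AddSubgroup F} (hD : LD D l v) :
    LD D l (T v) := by
  intro κ' h
  rw [apply_eq_sum]
  refine AddSubgroup.sum_mem _ fun κ hκ => ?_
  obtain ⟨⟨z, hz⟩, h2⟩ := GG_coeff (hT κ) κ'
  by_cases h0 : coeff κ' (T (monomial κ 1)) = 0
  · rw [h0, mul_zero]; exact D.zero_mem
  · have h3 := h2 h0
    have h4 := hv κ (mem_support_iff.1 hκ)
    rw [h] at h3
    rw [hz, mul_comm, ← zsmul_eq_mul]
    exact D.zsmul_mem (hD κ (h4.antisymm h3)) z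

theorem coeff_Eop {N : ℕ} (i : Fin N) (v : MvPolynomial (Fin N) F) (κ : Fin N →₀ ℕ) :
    coeff κ (Eop F i v) = (κ i : F) * coeff κ v := by
  rw [Eop_apply]
  induction v using MvPolynomial.induction_on' with
  | monomial u a =>
    rw [X_mul_pderiv_monomial, coeff_smul, coeff_monomial]
    split_ifs with h
    · subst h; simp
    · simp
  | add p q hp hq => rw [map_add, mul_add, coeff_add, coeff_add, hp, hq, mul_add]

theorem Eop_WW {N : ℕ} (i : Fin N) {l : JPartition} {v : MvPolynomial (Fin N) F} (hv : v ∈ WW N l) :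
    Eop F i v ∈ WW N l := by
  rw [mem_WW] at *
  intro κ h
  rw [coeff_Eop] at h
  exact hv κ (right_ne_zero_of_mul h)

/-! ### Leading terms of eigenvalues -/

def DD (k : ℕ) : AddSubgroup F :=
  (Polynomial.degreeLT ℚ k).toAddSubgroup.map (algebraMap (Polynomial ℚ) F).toAddMonoidHom

theorem mem_DD {k : ℕ} {x : F} : x ∈ DD k ↔ ∃ p : Polynomial ℚ, p.degree < k ∧ algebraMap _ F p = x := by
  rw [DD, AddSubgroup.mem_map]
  constructor
  · rintro ⟨p, hp, rfl⟩
    exact ⟨p, Polynomial.mem_degreeLT.1 hp, rfl⟩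
  · rintro ⟨p, hp, rfl⟩
    exact ⟨p, Polynomial.mem_degreeLT.2 hp, rfl⟩

theorem alpha_eq : alpha = algebraMap (Polynomial ℚ) F Polynomial.X := (RatFunc.algebraMap_X).symm

theorem algebraMap_C_F (c : ℚ) : algebraMap (Polynomial ℚ) F (Polynomial.C c) = algebraMap ℚ F c := by
  rw [RatFunc.algebraMap_C]
  exact DFunLike.congr_fun (Subsingleton.elim (RatFunc.C : ℚ →+* F) (algebraMap ℚ F)) c

theorem alpha_pow_mul_mem_DD {k : ℕ} (c : ℚ) : alpha ^ k * algebraMap ℚ F c ∈ DD k ↔ c = 0 := by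
  have e : alpha ^ k * algebraMap ℚ F c = algebraMap (Polynomial ℚ) F (Polynomial.C c * Polynomial.X ^ k) := by
    rw [map_mul, map_pow, ← alpha_eq, mul_comm, algebraMap_C_F]
  rw [e, mem_DD]
  constructor
  · rintro ⟨p, hp, h⟩
    have := RatFunc.algebraMap_injective ℚ h
    subst this
    by_contra hc
    rw [Polynomial.degree_C_mul_X_pow k hc] at hp
    exact lt_irrefl _ hp
  · rintro rfl
    exact ⟨0, by simp, by simp⟩

theorem DD_mono {k l : ℕ} (h : k ≤ l) {x : F} (hx : x ∈ DD k) : x ∈ DD l := by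
  rw [mem_DD] at *
  obtain ⟨p, hp, rfl⟩ := hx
  exact ⟨p, hp.trans_le (by exact_mod_cast h), rfl⟩

theorem DD_alpha {k : ℕ} (n : ℕ) {x : F} (hx : x ∈ DD k) : alpha * (n * x) ∈ DD (k + 1) := by
  rw [mem_DD] at *
  obtain ⟨p, hp, rfl⟩ := hx
  refine ⟨Polynomial.X * ((n : Polynomial ℚ) * p), ?_, by rw [map_mul, ← alpha_eq, map_mul, map_natCast]⟩
  by_cases h0 : (n : Polynomial ℚ) * p = 0
  · rw [h0]; simp
  rw [mul_comm, Polynomial.degree_mul_X]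
  have h1 : ((n : Polynomial ℚ) * p).degree ≤ p.degree := by
    rw [← nsmul_eq_mul]; exact Polynomial.degree_smul_le _ _
  have h2 := h1.trans_lt hp
  rw [Polynomial.degree_eq_natDegree h0] at *
  exact_mod_cast Nat.succ_lt_succ (by exact_mod_cast h2)

theorem pow_mem_DD (k n : ℕ) : alpha ^ k * (n : F) ^ k ∈ DD (k + 1) := by
  rw [mem_DD]
  refine ⟨Polynomial.C ((n : ℚ) ^ k) * Polynomial.X ^ k, ?_, ?_⟩
  · refine (Polynomial.degree_C_mul_X_pow_le _ _).trans_lt ?_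
    exact_mod_cast Nat.lt_succ_self k
  · rw [map_mul, map_pow _ Polynomial.X, ← alpha_eq, mul_comm, algebraMap_C_F]
    simp

theorem lead_pow {N : ℕ} {R : Module.End F (MvPolynomial (Fin N) F)} (hR : Good R) (i : Fin N)
    {l : JPartition} {v : MvPolynomial (Fin N) F} (hv : v ∈ WW N l)
    (h1 : ∀ κ, partOf κ = l → coeff κ v = 1) (k : ℕ) :
    ((alpha • Eop F i + R) ^ k) v ∈ WW N l ∧
    ∀ κ, partOf κ = l → coeff κ (((alpha • Eop F i + R) ^ k) v) - alpha ^ k * (κ i : F) ^ k ∈ DD k := by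
  induction k with
  | zero =>
    refine ⟨by simpa using hv, fun κ hκ => ?_⟩
    simp only [pow_zero, Module.End.one_apply, h1 κ hκ, mul_one, sub_self]
    exact AddSubgroup.zero_mem _
  | succ k ih =>
    obtain ⟨hw, hl⟩ := ih
    rw [pow_succ', Module.End.mul_apply]
    generalize ((alpha • Eop F i + R) ^ k) v = w at hw hl
    rw [LinearMap.add_apply, LinearMap.smul_apply]
    refine ⟨Submodule.add_mem _ (Submodule.smul_mem _ _ (Eop_WW i hw)) (hR.presWW hw), fun κ hκ => ?_⟩
    have h2 : LD (DD (k + 1)) l w := by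
      intro κ1 hκ1
      have := AddSubgroup.add_mem _ (DD_mono (Nat.le_succ k) (hl κ1 hκ1)) (pow_mem_DD k (κ1 i))
      rwa [sub_add_cancel] at this
    have h3 := hR.presLD hw h2 κ hκ
    have h4 := DD_alpha (κ i) (hl κ hκ)
    have h5 := AddSubgroup.add_mem _ h3 h4
    rw [coeff_add, coeff_smul, coeff_Eop, smul_eq_mul]
    convert h5 using 1
    ring

/-- sum version -/
theorem lead_sum {N : ℕ} {T : Fin N → Module.End F (MvPolynomial (Fin N) F)}
    {R : Fin N → Module.End F (MvPolynomial (Fin N) F)} (hR : ∀ i, Good (R i))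
    (hT : ∀ i, T i = alpha • Eop F i + R i)
    {l : JPartition} {v : MvPolynomial (Fin N) F} (hv : v ∈ WW N l)
    (h1 : ∀ κ, partOf κ = l → coeff κ v = 1) (k : ℕ) (κ : Fin N →₀ ℕ) (hκ : partOf κ = l) :
    coeff κ ((∑ i, T i ^ k) v) - alpha ^ k * algebraMap ℚ F (∑ i, (κ i : ℚ) ^ k) ∈ DD k := by
  have := AddSubgroup.sum_mem (DD k) fun i (_ : i ∈ Finset.univ) => (lead_pow (hR i) i hv h1 k).2 κ hκ
  convert this using 1
  rw [Finset.sum_sub_distrib, LinearMap.sum_apply, coeff_sum, ← Finset.mul_sum, map_sum]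
  simp only [hT, map_pow, map_natCast]

theorem Zop_WW {N : ℕ} (i : Fin N) {l : JPartition} {v : MvPolynomial (Fin N) F} (hv : v ∈ WW N l) :
    Zop alpha i v ∈ WW N l := by
  rw [Zop, LinearMap.add_apply, LinearMap.smul_apply]
  exact Submodule.add_mem _ (Submodule.smul_mem _ _ (Eop_WW i hv))
    ((Good.sum _ fun j _ => Good_Aop i j).presWW hv)

theorem Good_sum_sij {N : ℕ} (i : Fin N) : Good (∑ j ∈ Finset.Ioi i, sij F i j) :=
  Good.sum _ fun _ _ => Good_Sg _

theorem Yop_WW {N : ℕ} (i : Fin N) {l : JPartition} {v : MvPolynomial (Fin N) F} (hv : v ∈ WW N l) :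
    Yop alpha i v ∈ WW N l := by
  rw [Yop, LinearMap.add_apply]
  exact Submodule.add_mem _ (Zop_WW i hv) ((Good_sum_sij i).presWW hv)

theorem pow_WW {N : ℕ} {T : Module.End F (MvPolynomial (Fin N) F)} {l : JPartition}
    (hT : ∀ v ∈ WW N l, T v ∈ WW N l) (k : ℕ) : ∀ v ∈ WW N l, (T ^ k) v ∈ WW N l := by
  induction k with
  | zero => intro v hv; simpa using hv
  | succ k ih => intro v hv; rw [pow_succ', Module.End.mul_apply]; exact hT _ (ih v hv)

theorem ZZ_WW {N : ℕ} {l : JPartition} : ∀ b ∈ ZZ alpha N, ∀ v ∈ WW N l, b v ∈ WW N l := by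
  intro b hb
  induction hb using Algebra.adjoin_induction with
  | mem x hx =>
    obtain ⟨k, rfl⟩ := hx
    intro v hv
    rw [cop, LinearMap.sum_apply]
    exact Submodule.sum_mem _ fun i _ => pow_WW (fun v hv => Yop_WW i hv) k v hv
  | algebraMap r =>
    intro v hv
    rw [Module.algebraMap_end_apply]
    exact Submodule.smul_mem _ _ hv
  | add x y _ _ hx hy =>
    intro v hv
    rw [LinearMap.add_apply]
    exact Submodule.add_mem _ (hx v hv) (hy v hv)
  | mul x y _ _ hx hy =>
    intro v hv
    rw [Module.End.mul_apply]
    exact hx _ (hy v hv)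

theorem lead_Z {N : ℕ} {l : JPartition} {v : MvPolynomial (Fin N) F} (hv : v ∈ WW N l)
    (h1 : ∀ κ, partOf κ = l → coeff κ v = 1) (k : ℕ) (κ : Fin N →₀ ℕ) (hκ : partOf κ = l) :
    coeff κ ((∑ i, (Zop alpha i : Module.End F (MvPolynomial (Fin N) F)) ^ k) v)
      - alpha ^ k * algebraMap ℚ F (∑ i, (κ i : ℚ) ^ k) ∈ DD k :=
  lead_sum (fun i => Good.sum _ fun j _ => Good_Aop i j) (fun _ => rfl) hv h1 k κ hκ

theorem lead_cop {N : ℕ} {l : JPartition} {v : MvPolynomial (Fin N) F} (hv : v ∈ WW N l)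
    (h1 : ∀ κ, partOf κ = l → coeff κ v = 1) (k : ℕ) (κ : Fin N →₀ ℕ) (hκ : partOf κ = l) :
    coeff κ (cop alpha N k v) - alpha ^ k * algebraMap ℚ F (∑ i, (κ i : ℚ) ^ k) ∈ DD k :=
  lead_sum (R := fun i => (∑ j, Aop F i j) + ∑ j ∈ Finset.Ioi i, sij F i j)
    (fun i => (Good.sum _ fun j _ => Good_Aop i j).add (Good_sum_sij i))
    (fun i => by rw [Yop, Zop, add_assoc]) hv h1 k κ hκ

/-! ### Power sums determine the partition -/

theorem count_of_powersums {N : ℕ} {κ κ' : Fin N →₀ ℕ}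
    (h : ∀ k, ∑ i, (κ i : ℚ) ^ (k + 1) = ∑ i, (κ' i : ℚ) ^ (k + 1)) : partOf κ = partOf κ' := by
  have h0 : ∀ k, ∑ i, (κ i : ℚ) ^ k = ∑ i, (κ' i : ℚ) ^ k := by
    intro k
    cases k with
    | zero => simp
    | succ k => exact h k
  have hp : ∀ p : Polynomial ℚ, ∑ i, p.eval (κ i : ℚ) = ∑ i, p.eval (κ' i : ℚ) := by
    intro p
    induction p using Polynomial.induction_on' with
    | add p q hp hq => simp only [Polynomial.eval_add, Finset.sum_add_distrib, hp, hq]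
    | monomial n a => simp only [Polynomial.eval_monomial, ← Finset.mul_sum, h0]
  have hf : ∀ f : ℕ → ℚ, ∑ i, f (κ i) = ∑ i, f (κ' i) := by
    intro f
    let S : Finset ℕ := Finset.univ.image κ ∪ Finset.univ.image κ'
    let p := Lagrange.interpolate S (fun n : ℕ => (n : ℚ)) f
    have he : ∀ n ∈ S, p.eval (n : ℚ) = f n := fun n hn =>
      Lagrange.eval_interpolate_at_node f (fun a _ b _ h => by exact_mod_cast h) hn
    have h1 := hp p
    rw [Finset.sum_congr rfl fun i _ => he (κ i) (by simp [S]),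
      Finset.sum_congr rfl fun i _ => he (κ' i) (by simp [S])] at h1
    exact h1
  have e : ∀ t, ppl (partOf κ) t = ppl (partOf κ') t := by
    intro t
    have := hf fun n => ((n - t : ℕ) : ℚ)
    rw [ppl_partOf, ppl_partOf]
    exact_mod_cast this
  exact Domp.antisymm ⟨by rw [psize_ppl, psize_ppl, e], fun t => (e t).le⟩
    ⟨by rw [psize_ppl, psize_ppl, e], fun t => (e t).ge⟩

/-! ### Homogeneity and Jack polynomials -/

theorem evalN_monomial_hom (N : ℕ) (m : Exp) (c : F) :
    (evalN N (monomial m c)).IsHomogeneous (wt m) := by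
  rw [evalN, aeval_monomial]
  have h1 : (m.prod fun i k => (∑ j : Fin N, (X j : MvPolynomial (Fin N) F) ^ (i : ℕ)) ^ k).IsHomogeneous
      (wt m) := by
    rw [Finsupp.prod, wt, Finsupp.sum]
    refine IsHomogeneous.prod _ _ _ fun i _ => ?_
    rw [mul_comm]
    refine IsHomogeneous.pow ?_ _
    exact IsHomogeneous.sum _ _ _ fun j _ => isHomogeneous_X_pow j _
  have h2 := (isHomogeneous_C (Fin N) c).mul h1
  rwa [zero_add] at h2

theorem coeff_evalN_eq_zero {N : ℕ} {g : SymA} {κ : Fin N →₀ ℕ}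
    (hg : ∀ m, wt m = ∑ i, κ i → coeff m g = 0) : coeff κ (evalN N g) = 0 := by
  rw [g.as_sum, map_sum, coeff_sum]
  refine Finset.sum_eq_zero fun m hm => ?_
  refine (evalN_monomial_hom N m _).coeff_eq_zero ?_
  rw [Finsupp.degree_eq_sum]
  intro h
  exact mem_support_iff.1 hm (hg m h.symm)

theorem coeff_evalN_Lam {N n : ℕ} {g : SymA} (hg : g ∈ Lam n) {κ : Fin N →₀ ℕ}
    (hκ : ∑ i, κ i ≠ n) : coeff κ (evalN N g) = 0 :=
  coeff_evalN_eq_zero fun m hm => hg m (by rw [hm]; exact hκ)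

theorem eq_zero_of_coeffs {N n : ℕ} (hn : n ≤ N) {v : MvPolynomial (Fin N) F}
    (hs : ∀ σ, Sg F σ v = v) (hh : ∀ κ, ∑ i, κ i ≠ n → coeff κ v = 0)
    (h : ∀ l : Pt n, coeff (xexp l.1 N) v = 0) : v = 0 := by
  refine MvPolynomial.ext _ _ fun κ => ?_
  rw [coeff_zero]
  by_cases hκ : ∑ i, κ i = n
  · have hp : psize (partOf κ) = n := by rw [psize_partOf, hκ]
    rw [← h ⟨partOf κ, hp⟩]
    apply coeff_perm hs
    have := plen_le_psize (partOf κ)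
    exact (partOf_xexp (partOf κ) N (by omega)).symm
  · exact hh κ hκ

theorem J_mem_WW {J : JPartition → SymA} (hJ : IsJackFamily J) (l : JPartition) (N : ℕ) :
    evalN N (J l) ∈ WW N l := by
  rw [mem_WW]
  intro κ h
  by_contra hc
  apply h
  have h1 := hJ.triangular l (partOf κ) (fun hd => hc (Domp_of_dominates hd))
  rw [← h1]
  apply coeff_stab
  rw [partOf_xexp]
  omega

theorem J_mem_Lam {J : JPartition → SymA} (hJ : IsJackFamily J) (l : JPartition) :
    J l ∈ Lam (psize l) := by
  intro m hm
  let f := J l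
  let g : SymA := ∑ m' ∈ f.support.filter (fun m' => wt m' = wt m), monomial m' (coeff m' f)
  have hgc : ∀ m', wt m' = wt m → coeff m' g = coeff m' f := by
    intro m' hm'
    simp only [g, coeff_sum, coeff_monomial]
    rw [Finset.sum_ite_eq']
    split_ifs with h
    · rfl
    · simp only [Finset.mem_filter, mem_support_iff, not_and, hm'] at h
      by_contra hc
      exact h (fun h0 => hc h0.symm) trivial
  have hg : g ∈ Lam (wt m) := by
    refine Submodule.sum_mem _ fun m' hm' => ?_
    rw [← (Finset.mem_filter.1 hm').2]
    exact monomial_mem_Lam _ _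
  have h0 : g = 0 := by
    apply Inj_all (wt m) (wt m) le_rfl g hg
    refine MvPolynomial.ext _ _ fun κ => ?_
    rw [coeff_zero]
    by_cases hκ : ∑ i, κ i = wt m
    · have h1 : coeff κ (evalN (wt m) (f - g)) = 0 := by
        apply coeff_evalN_eq_zero
        intro m' hm'
        rw [coeff_sub, hgc m' (hm'.trans hκ), sub_self]
      rw [map_sub, coeff_sub] at h1
      rw [← sub_eq_zero.1 h1]
      by_contra hc
      have h2 := (J_mem_WW hJ l _ κ hc).1
      rw [psize_partOf, hκ] at h2
      exact hm h2
    · exact coeff_evalN_Lam hg hκ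
  rw [← hgc m rfl, h0, coeff_zero]

section
variable {J : JPartition → SymA} (hJ : IsJackFamily J)

theorem J_ne_zero (hJ : IsJackFamily J) (l : JPartition) : J l ≠ 0 := by
  intro h
  have := hJ.normalized l
  rw [h, coeff_zero] at this
  exact zero_ne_one this

theorem J_norm (hJ : IsJackFamily J) (l : JPartition) : hall (J l) (J l) ≠ 0 :=
  fun h => J_ne_zero hJ l (hall_self_eq_zero h)

theorem J_mem (hJ : IsJackFamily J) {n : ℕ} (l : Pt n) : J l.1 ∈ Lam n := by
  have := J_mem_Lam hJ l.1
  rwa [l.2] at this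

theorem hall_sum_J (hJ : IsJackFamily J) {n : ℕ} (c : Pt n → F) (m : Pt n) :
    hall (∑ l, c l • J l.1) (J m.1) = c m * hall (J m.1) (J m.1) := by
  rw [hall_sum_left, Finset.sum_eq_single m]
  · rw [hall_smul_left]
  · intro b _ hb
    rw [hall_smul_left, hJ.orthogonal _ _ (fun h => hb (Subtype.ext h)), mul_zero]
  · simp

theorem J_indep (hJ : IsJackFamily J) {n : ℕ} {c : Pt n → F} (h : ∑ l, c l • J l.1 = 0) : c = 0 := by
  funext m
  have := hall_sum_J hJ c m
  rw [h, hall_zero_left] at this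
  exact (mul_eq_zero.1 this.symm).resolve_right (J_norm hJ _)

theorem J_indep' (hJ : IsJackFamily J) {n : ℕ} {c d : Pt n → F}
    (h : ∑ l, c l • J l.1 = ∑ l, d l • J l.1) : c = d := by
  rw [← sub_eq_zero]
  apply J_indep hJ
  simp only [Pi.sub_apply, sub_smul, Finset.sum_sub_distrib, h, sub_self]

def Pm (J : JPartition → SymA) (n : ℕ) : Matrix (Pt n) (Pt n) F := fun l m => coeff (toExp m.1) (J l.1)

theorem sum_J_mem (hJ : IsJackFamily J) {n : ℕ} (c : Pt n → F) : ∑ l, c l • J l.1 ∈ Lam n :=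
  Submodule.sum_mem _ fun l _ => Submodule.smul_mem _ _ (J_mem hJ l)

theorem eq_of_Lam {n : ℕ} {f g : SymA} (hf : f ∈ Lam n) (hg : g ∈ Lam n)
    (h : ∀ l : Pt n, coeff (toExp l.1) f = coeff (toExp l.1) g) : f = g := by
  rw [Lam_sum hf, Lam_sum hg]
  exact Finset.sum_congr rfl fun l _ => by rw [h l]

theorem vecMul_Pm {n : ℕ} (c : Pt n → F) (m : Pt n) :
    Matrix.vecMul c (Pm J n) m = coeff (toExp m.1) (∑ l, c l • J l.1) := by
  simp [Matrix.vecMul, dotProduct, Pm, coeff_sum]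

theorem Pm_unit (hJ : IsJackFamily J) (n : ℕ) : IsUnit (Pm J n) := by
  rw [← Matrix.vecMul_injective_iff_isUnit]
  intro c d h
  apply J_indep' hJ
  apply eq_of_Lam (sum_J_mem hJ c) (sum_J_mem hJ d)
  intro l
  rw [← vecMul_Pm, ← vecMul_Pm]
  exact congrFun h l

theorem J_expand (hJ : IsJackFamily J) {n : ℕ} {f : SymA} (hf : f ∈ Lam n) :
    ∃ c : Pt n → F, f = ∑ l, c l • J l.1 := by
  obtain ⟨c, hc⟩ := Matrix.vecMul_surjective_iff_isUnit.2 (Pm_unit hJ n) (fun m => coeff (toExp m.1) f)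
  refine ⟨c, eq_of_Lam hf (sum_J_mem hJ c) fun l => ?_⟩
  rw [← vecMul_Pm]
  exact (congrFun hc l).symm

def Km (J : JPartition → SymA) (N n : ℕ) : Matrix (Pt n) (Pt n) F :=
  fun l m => coeff (xexp m.1 N) (evalN N (J l.1))

theorem vecMul_Km {N n : ℕ} (c : Pt n → F) (m : Pt n) :
    Matrix.vecMul c (Km J N n) m = coeff (xexp m.1 N) (evalN N (∑ l, c l • J l.1)) := by
  simp [Matrix.vecMul, dotProduct, Km, coeff_sum, map_sum]

theorem Km_unit (hJ : IsJackFamily J) {N n : ℕ} (hn : n ≤ N) : IsUnit (Km J N n) := by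
  rw [← Matrix.vecMul_injective_iff_isUnit]
  intro c d h
  apply J_indep' hJ
  rw [← sub_eq_zero]
  have hm := Submodule.sub_mem _ (sum_J_mem hJ c) (sum_J_mem hJ d)
  apply Inj_all N n hn _ hm
  apply eq_zero_of_coeffs hn
  · intro σ; exact Sg_evalN σ _
  · intro κ hκ; exact coeff_evalN_Lam hm hκ
  · intro l
    rw [map_sub, coeff_sub, ← vecMul_Km, ← vecMul_Km, sub_eq_zero]
    exact congrFun h l

theorem partOf_xexp' {N n : ℕ} (hn : n ≤ N) (l : Pt n) : partOf (xexp l.1 N) = l.1 := by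
  apply partOf_xexp
  have := plen_le_psize l.1
  rw [l.2] at this
  omega

theorem Km_tri (hJ : IsJackFamily J) {N n : ℕ} (hn : n ≤ N) {l m : Pt n} (h : Km J N n l m ≠ 0) :
    Domp m.1 l.1 := by
  have := J_mem_WW hJ l.1 N _ h
  rwa [partOf_xexp' hn] at this

theorem Km_inv_tri (hJ : IsJackFamily J) {N n : ℕ} (hn : n ≤ N) {l m : Pt n}
    (h : (Km J N n)⁻¹ l m ≠ 0) : Domp m.1 l.1 := by
  haveI := (Km_unit hJ hn).invertible
  have hb : Matrix.BlockTriangular (Km J N n) (fun m : Pt n => if Domp m.1 l.1 then (1 : ℕ) else 0) := by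
    intro i j hij
    by_contra hc
    have h1 := Km_tri hJ hn hc
    by_cases hi : Domp i.1 l.1
    · have : Domp j.1 l.1 := h1.trans hi
      simp [hi, this] at hij
    · simp [hi] at hij
  have h2 := Matrix.blockTriangular_inv_of_blockTriangular hb
  by_contra hc
  apply h
  apply h2
  simp [hc, Domp.refl]

theorem Km_diag (hJ : IsJackFamily J) {N n : ℕ} (hn : n ≤ N) (l : Pt n) : Km J N n l l ≠ 0 := by
  haveI := (Km_unit hJ hn).invertible
  have h := congrFun (congrFun (Matrix.mul_inv_of_invertible (Km J N n)) l) l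
  rw [Matrix.mul_apply, Finset.sum_eq_single l] at h
  · intro h0
    rw [h0, zero_mul, Matrix.one_apply_eq] at h
    exact zero_ne_one h
  · intro b _ hb
    by_contra hc
    exact hb (Subtype.ext ((Km_tri hJ hn (left_ne_zero_of_mul hc)).antisymm
      (Km_inv_tri hJ hn (right_ne_zero_of_mul hc))))
  · simp

theorem J_tri (hJ : IsJackFamily J) {N n : ℕ} (hn : n ≤ N) {c : Pt n → F} {l : Pt n}
    (h : evalN N (∑ l, c l • J l.1) ∈ WW N l.1) (m : Pt n) (hm : c m ≠ 0) : Domp m.1 l.1 := by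
  haveI := (Km_unit hJ hn).invertible
  have h1 : c = Matrix.vecMul (Matrix.vecMul c (Km J N n)) (Km J N n)⁻¹ := by
    rw [Matrix.vecMul_vecMul, Matrix.mul_inv_of_invertible, Matrix.vecMul_one]
  rw [h1] at hm
  obtain ⟨r, _, hr⟩ := Finset.exists_ne_zero_of_sum_ne_zero hm
  have h2 := Km_inv_tri hJ hn (right_ne_zero_of_mul hr)
  have h3 := left_ne_zero_of_mul hr
  rw [vecMul_Km] at h3
  have h4 := h _ h3
  rw [partOf_xexp' hn] at h4
  exact h2.trans h4

theorem exists_of_sym (hJ : IsJackFamily J) {N n : ℕ} (hn : n ≤ N) {v : MvPolynomial (Fin N) F}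
    (hs : ∀ σ, Sg F σ v = v) (hh : ∀ κ, ∑ i, κ i ≠ n → coeff κ v = 0) :
    ∃ c : Pt n → F, v = evalN N (∑ l, c l • J l.1) := by
  obtain ⟨c, hc⟩ := Matrix.vecMul_surjective_iff_isUnit.2 (Km_unit hJ hn) (fun m => coeff (xexp m.1 N) v)
  refine ⟨c, ?_⟩
  rw [← sub_eq_zero]
  apply eq_zero_of_coeffs hn
  · intro σ; rw [map_sub, hs, Sg_evalN]
  · intro κ hκ; rw [coeff_sub, hh κ hκ, coeff_evalN_Lam (sum_J_mem hJ c) hκ, sub_zero]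
  · intro l
    rw [coeff_sub, ← vecMul_Km, sub_eq_zero]
    exact (congrFun hc l).symm

/-! ### Eigenvalues -/

theorem evalN_Hf' {N n k : ℕ} {f : SymA} (hf : f ∈ Lam n) :
    evalN N (Hf N n k f) = (∑ i : Fin N, (Zop alpha i) ^ (k+1) : Module.End F (MvPolynomial (Fin N) F)) (evalN N f) := by
  rw [evalN_Hf hf, LinearMap.sum_apply]

theorem Hf_eigen (hJ : IsJackFamily J) {N n : ℕ} (hn : n ≤ N) (k : ℕ) (l : Pt n) :
    ∃ h : F, Hf N n k (J l.1) = h • J l.1 := by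
  have hW : ∀ m : Pt n, evalN N (Hf N n k (J m.1)) ∈ WW N m.1 := by
    intro m
    rw [evalN_Hf (J_mem hJ m)]
    exact Submodule.sum_mem _ fun i _ => pow_WW (fun v hv => Zop_WW i hv) _ _ (J_mem_WW hJ m.1 N)
  have key : ∀ a b : Pt n, hall (Hf N n k (J a.1)) (J b.1) ≠ 0 → Domp b.1 a.1 := by
    intro a b h
    obtain ⟨c, hc⟩ := J_expand hJ (Hf_mem (N := N) (k := k) (J_mem hJ a))
    rw [hc, hall_sum_J hJ] at h
    have h2 := hW a
    rw [hc] at h2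
    exact J_tri hJ hn h2 b (left_ne_zero_of_mul h)
  obtain ⟨c, hc⟩ := J_expand hJ (Hf_mem (N := N) (k := k) (J_mem hJ l))
  refine ⟨c l, ?_⟩
  rw [hc, Finset.sum_eq_single l]
  · intro b _ hb
    by_contra hcb
    have h0 : c b ≠ 0 := left_ne_zero_of_smul hcb
    have h1 : hall (Hf N n k (J l.1)) (J b.1) ≠ 0 := by
      rw [hc, hall_sum_J hJ]; exact mul_ne_zero h0 (J_norm hJ _)
    have h2 := key l b h1
    rw [hall_Hf, hall_symm] at h1
    exact hb (Subtype.ext (h2.antisymm (key b l h1)))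
  · simp

/-- Separation: if operators with leading-term control have equal eigenvalues, partitions agree. -/
theorem sep (hJ : IsJackFamily J) {N n : ℕ} (hn : n ≤ N)
    (T : ℕ → Module.End F (MvPolynomial (Fin N) F))
    (hT : ∀ (l : JPartition) (v : MvPolynomial (Fin N) F), v ∈ WW N l →
      (∀ κ, partOf κ = l → coeff κ v = 1) → ∀ k κ, partOf κ = l →
      coeff κ (T k v) - alpha ^ (k + 1) * algebraMap ℚ F (∑ i, (κ i : ℚ) ^ (k + 1)) ∈ DD (k + 1))
    (e : ℕ → Pt n → F) (he : ∀ k l, T k (evalN N (J l.1)) = e k l • evalN N (J l.1))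
    {l m : Pt n} (h : ∀ k, e k l = e k m) : l = m := by
  have h1 : ∀ k (l : Pt n), e k l - alpha ^ (k + 1) *
      algebraMap ℚ F (∑ i, ((xexp l.1 N i : ℕ) : ℚ) ^ (k + 1)) ∈ DD (k + 1) := by
    intro k l
    have hd := Km_diag hJ hn l
    have h2 : ∀ κ, partOf κ = l.1 → coeff κ ((Km J N n l l)⁻¹ • evalN N (J l.1)) = 1 := by
      intro κ hκ
      rw [coeff_smul, smul_eq_mul]
      have : coeff κ (evalN N (J l.1)) = Km J N n l l :=
        coeff_stab _ (hκ.trans (partOf_xexp' hn l).symm)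
      rw [this, inv_mul_cancel₀ hd]
    have h3 := hT l.1 _ (Submodule.smul_mem _ (Km J N n l l)⁻¹ (J_mem_WW hJ l.1 N)) h2 k (xexp l.1 N)
      (partOf_xexp' hn l)
    rw [map_smul, he, smul_comm, coeff_smul, h2 _ (partOf_xexp' hn l), smul_eq_mul, mul_one] at h3
    exact h3
  apply Subtype.ext
  rw [← partOf_xexp' hn l, ← partOf_xexp' hn m]
  apply count_of_powersums
  intro k
  have h4 := AddSubgroup.sub_mem _ (h1 k m) (h1 k l)
  rw [h k, sub_sub_sub_cancel_left, ← mul_sub, ← map_sub, alpha_pow_mul_mem_DD] at h4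
  exact sub_eq_zero.1 h4

theorem ZZ_eigen (hJ : IsJackFamily J) {M n : ℕ} (hn : n ≤ M + 1) :
    ∀ b ∈ ZZ alpha (M + 1), ∀ l : Pt n, ∃ e : F, b (evalN (M+1) (J l.1)) = e • evalN (M+1) (J l.1) := by
  intro b hb l
  have hw := ZZ_WW b hb _ (J_mem_WW hJ l.1 (M+1))
  obtain ⟨c, hc⟩ := exists_of_sym hJ hn (v := b (evalN (M+1) (J l.1)))
    (by
      intro σ
      rw [← Module.End.mul_apply, Sg_comm_ZZ alpha σ b hb, Module.End.mul_apply, Sg_evalN])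
    (by
      intro κ hκ
      by_contra h0
      have := (hw κ h0).1
      rw [psize_partOf, l.2] at this
      exact hκ this)
  choose h hh using fun (k : ℕ) (l : Pt n) => Hf_eigen hJ hn (N := M+1) k l
  have he : ∀ k (l : Pt n), (∑ i : Fin (M+1), (Zop alpha i) ^ (k+1) : Module.End F (MvPolynomial (Fin (M+1)) F))
      (evalN (M+1) (J l.1)) = h k l • evalN (M+1) (J l.1) := by
    intro k l
    rw [← evalN_Hf' (J_mem hJ l), hh, map_smul]
  have hcomm : ∀ k, (∑ i : Fin (M+1), (Zop alpha i) ^ (k+1) : Module.End F (MvPolynomial (Fin (M+1)) F)) * b =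
      b * ∑ i : Fin (M+1), (Zop alpha i) ^ (k+1) := by
    intro k
    rw [Finset.sum_mul, Finset.mul_sum]
    exact Finset.sum_congr rfl fun i _ => (Commute.pow_left (Zop_comm_ZZ alpha i b hb) (k+1))
  have hc0 : ∀ m, m ≠ l → c m = 0 := by
    intro m hm
    by_contra hcm
    apply hm
    refine sep hJ hn (fun k => ∑ i, (Zop alpha i) ^ (k+1)) ?_ h he fun k => ?_
    · intro l v hv h1 k κ hκ
      exact lead_Z hv h1 (k+1) κ hκ
    · have h1 := DFunLike.congr_fun (hcomm k) (evalN (M+1) (J l.1))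
      rw [Module.End.mul_apply, Module.End.mul_apply, he, map_smul, hc] at h1
      have h2 : (∑ i : Fin (M+1), (Zop alpha i) ^ (k+1) : Module.End F (MvPolynomial (Fin (M+1)) F))
          (evalN (M+1) (∑ l, c l • J l.1)) = evalN (M+1) (∑ l, (c l * h k l) • J l.1) := by
        rw [map_sum, map_sum, map_sum]
        refine Finset.sum_congr rfl fun r _ => ?_
        rw [map_smul, map_smul, map_smul, he, smul_smul]
      have h3 : h k l • evalN (M+1) (∑ l, c l • J l.1) =
          evalN (M+1) (∑ m, (h k l * c m) • J m.1) := by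
        rw [← map_smul, Finset.smul_sum]
        simp only [smul_smul]
      rw [h2, h3] at h1
      have h4 := congrFun (J_indep' hJ (evalN_inj hn (sum_J_mem hJ _) (sum_J_mem hJ _) h1)) m
      rw [mul_comm] at h4
      exact mul_right_cancel₀ hcm h4
  refine ⟨c l, ?_⟩
  rw [hc, Finset.sum_eq_single l, map_smul]
  · intro m _ hm
    rw [hc0 m hm, zero_smul]
  · simp

theorem ZZ_realize (hJ : IsJackFamily J) {M n : ℕ} (hn : n ≤ M + 1) (φ : Pt n → F) :
    ∃ b ∈ ZZ alpha (M + 1), ∀ l : Pt n, b (evalN (M+1) (J l.1)) = φ l • evalN (M+1) (J l.1) := by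
  let S : Subalgebra F (Pt n → F) :=
    { carrier := {φ | ∃ b ∈ ZZ alpha (M + 1), ∀ l : Pt n, b (evalN (M+1) (J l.1)) = φ l • evalN (M+1) (J l.1)}
      mul_mem' := by
        rintro a b ⟨a', ha', ha⟩ ⟨b', hb', hb⟩
        refine ⟨a' * b', Subalgebra.mul_mem _ ha' hb', fun l => ?_⟩
        rw [Module.End.mul_apply, hb, map_smul, ha, smul_smul, Pi.mul_apply, mul_comm]
      add_mem' := by
        rintro a b ⟨a', ha', ha⟩ ⟨b', hb', hb⟩
        refine ⟨a' + b', Subalgebra.add_mem _ ha' hb', fun l => ?_⟩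
        rw [LinearMap.add_apply, hb, ha, Pi.add_apply, add_smul]
      algebraMap_mem' := by
        intro r
        refine ⟨algebraMap _ _ r, Subalgebra.algebraMap_mem _ r, fun l => ?_⟩
        rw [Module.algebraMap_end_apply]
        rfl }
  suffices hS : φ ∈ S from hS
  choose e he using fun (k : ℕ) (l : Pt n) =>
    ZZ_eigen hJ hn (cop alpha (M+1) (k+1)) (Algebra.subset_adjoin ⟨k+1, rfl⟩) l
  have heS : ∀ k, e k ∈ S := fun k => ⟨_, Algebra.subset_adjoin ⟨k+1, rfl⟩, he k⟩
  have hsep : ∀ l m : Pt n, l ≠ m → ∃ u ∈ S, u l = 1 ∧ u m = 0 := by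
    intro l m hlm
    have : ∃ k, e k l ≠ e k m := by
      by_contra hc
      push Not at hc
      exact hlm (sep hJ hn (fun k => cop alpha (M+1) (k+1))
        (fun l v hv h1 k κ hκ => lead_cop hv h1 (k+1) κ hκ) e he hc)
    obtain ⟨k, hk⟩ := this
    refine ⟨(e k l - e k m)⁻¹ • (e k - algebraMap F (Pt n → F) (e k m)),
      S.smul_mem (S.sub_mem (heS k) (S.algebraMap_mem _)) _, ?_, ?_⟩
    · simp [inv_mul_cancel₀ (sub_ne_zero.2 hk)]
    · simp
  have hdelta : ∀ l : Pt n, Pi.single l (1 : F) ∈ S := by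
    intro l
    choose! u hu using hsep l
    have h1 : Pi.single l (1 : F) = ∏ m ∈ Finset.univ.erase l, u m := by
      funext r
      rw [Finset.prod_apply]
      rcases eq_or_ne r l with rfl | hr
      · rw [Pi.single_eq_same, Finset.prod_eq_one]
        intro m hm
        exact (hu m (Finset.ne_of_mem_erase hm).symm).2.1
      · rw [Pi.single_eq_of_ne hr, Finset.prod_eq_zero (i := r)]
        · simp [hr]
        · exact (hu r hr.symm).2.2
    rw [h1]
    exact Subalgebra.prod_mem _ fun m hm => (hu m (Finset.ne_of_mem_erase hm).symm).1
  have h2 : φ = ∑ l, φ l • Pi.single l (1 : F) := by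
    funext r
    simp [Finset.sum_apply, Pi.single_apply]
  rw [h2]
  exact Subalgebra.sum_mem _ fun l _ => S.smul_mem (hdelta l) _
end

/-! ### The lattices `MM` and `GJ` -/

def GJ (M n : ℕ) : AddSubgroup (MvPolynomial (Fin (M + 1)) F) :=
  AddSubgroup.closure {x | ∃ (k : ℕ) (g : SymA), g ∈ Lq ∧ g ∈ Lam (n - 1) ∧
    x = (Zop alpha 0 ^ k) (X 0 * evalN (M + 1) g)}

def MM (M n : ℕ) : AddSubgroup (MvPolynomial (Fin (M + 1)) F) where
  carrier := {x | ∃ v : ℕ → SymA, inV n v ∧ (∀ b ∈ Finset.Icc 1 n, v b ∈ Lq) ∧ x = EV (M + 1) n 0 v}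
  zero_mem' := ⟨fun _ => 0, fun _ _ => Submodule.zero_mem _, fun _ _ => AddSubgroup.zero_mem _,
    by simp [EV]⟩
  add_mem' := by
    rintro _ _ ⟨v, h1, h2, rfl⟩ ⟨w, h3, h4, rfl⟩
    refine ⟨fun b => v b + w b, fun b hb => Submodule.add_mem _ (h1 b hb) (h3 b hb),
      fun b hb => AddSubgroup.add_mem _ (h2 b hb) (h4 b hb), ?_⟩
    simp only [EV, map_add, mul_add, Finset.sum_add_distrib]
  neg_mem' := by
    rintro _ ⟨v, h1, h2, rfl⟩
    refine ⟨fun b => - v b, fun b hb => Submodule.neg_mem _ (h1 b hb),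
      fun b hb => AddSubgroup.neg_mem _ (h2 b hb), ?_⟩
    simp only [EV, map_neg, mul_neg, Finset.sum_neg_distrib]

theorem mem_MM {M n : ℕ} {x : MvPolynomial (Fin (M + 1)) F} : x ∈ MM M n ↔
    ∃ v : ℕ → SymA, inV n v ∧ (∀ b ∈ Finset.Icc 1 n, v b ∈ Lq) ∧ x = EV (M + 1) n 0 v := Iff.rfl

theorem Zop_MM {M n : ℕ} {x : MvPolynomial (Fin (M + 1)) F} (hx : x ∈ MM M n) :
    Zop alpha 0 x ∈ MM M n := by
  rw [mem_MM] at hx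
  obtain ⟨v, h1, h2, rfl⟩ := hx
  rw [Zop_EV 0 h1, mem_MM]
  refine ⟨_, inV_Zf h1, fun b hb => ?_, rfl⟩
  refine AddSubgroup.add_mem _ (smul_mem_Lq ?_ (h2 b hb)) (AddSubgroup.sum_mem _ fun a ha => ?_)
  · exact ZA.mul_mem (ZA.sub_mem alpha_mem_ZA ZA.one_mem) (natCast_mem _ _)
  · exact zco_mem_Lq (h2 a ha)

theorem Zop_pow_MM {M n : ℕ} {x : MvPolynomial (Fin (M + 1)) F} (hx : x ∈ MM M n) (k : ℕ) :
    (Zop alpha 0 ^ k) x ∈ MM M n := by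
  induction k with
  | zero => simpa using hx
  | succ k ih => rw [pow_succ', Module.End.mul_apply]; exact Zop_MM ih

theorem Zop_GJ {M n : ℕ} {x : MvPolynomial (Fin (M + 1)) F} (hx : x ∈ GJ M n) :
    Zop alpha 0 x ∈ GJ M n := by
  induction hx using AddSubgroup.closure_induction with
  | mem x hx =>
    obtain ⟨k, g, h1, h2, rfl⟩ := hx
    rw [← Module.End.mul_apply, ← pow_succ']
    exact AddSubgroup.subset_closure ⟨k + 1, g, h1, h2, rfl⟩
  | zero => rw [map_zero]; exact AddSubgroup.zero_mem _
  | add x y _ _ h1 h2 => rw [map_add]; exact AddSubgroup.add_mem _ h1 h2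
  | neg x _ h => rw [map_neg]; exact AddSubgroup.neg_mem _ h

theorem smul_GJ {M n : ℕ} {c : F} (hc : c ∈ ZA) {x : MvPolynomial (Fin (M + 1)) F} (hx : x ∈ GJ M n) :
    c • x ∈ GJ M n := by
  induction hx using AddSubgroup.closure_induction with
  | mem x hx =>
    obtain ⟨k, g, h1, h2, rfl⟩ := hx
    refine AddSubgroup.subset_closure ⟨k, c • g, smul_mem_Lq hc h1, Submodule.smul_mem _ _ h2, ?_⟩
    rw [map_smul, mul_smul_comm, map_smul]
  | zero => rw [smul_zero]; exact AddSubgroup.zero_mem _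
  | add x y _ _ h1 h2 => rw [smul_add]; exact AddSubgroup.add_mem _ h1 h2
  | neg x _ h => rw [smul_neg]; exact AddSubgroup.neg_mem _ h

theorem GJ_le_MM {M n : ℕ} (hn : 1 ≤ n) : GJ M n ≤ MM M n := by
  unfold GJ
  rw [AddSubgroup.closure_le]
  rintro _ ⟨k, g, h1, h2, rfl⟩
  apply Zop_pow_MM
  rw [mem_MM]
  refine ⟨fun b => if b = 1 then g else 0, fun b hb => ?_, fun b hb => ?_, ?_⟩
  · dsimp only
    split_ifs with h
    · rw [h]; exact h2
    · exact Submodule.zero_mem _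
  · dsimp only
    split_ifs with h
    · exact h1
    · exact AddSubgroup.zero_mem _
  · unfold EV
    rw [Finset.sum_eq_single 1]
    · simp
    · intro b _ hb; simp [hb]
    · intro h; exact absurd (Finset.mem_Icc.2 ⟨le_rfl, hn⟩) h

theorem degree_le_wt (m : Exp) : m.degree ≤ wt m := by
  unfold wt Finsupp.sum
  rw [Finsupp.degree_apply]
  exact Finset.sum_le_sum fun i _ => Nat.le_mul_of_pos_right _ i.pos

theorem GJ_step {M n : ℕ} (π : Exp) (r : ℕ) (hr : 2 ≤ r) (hw : r + wt π = n)
    (H1 : ∀ (π' : Exp) (r' : ℕ), π.degree < π'.degree → 1 ≤ r' → r' + wt π' = n →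
      X 0 ^ r' * evalN (M + 1) (qq π') ∈ GJ M n)
    (H2 : ∀ (π' : Exp) (r' : ℕ), π'.degree = π.degree → r < r' → r' + wt π' = n →
      X 0 ^ r' * evalN (M + 1) (qq π') ∈ GJ M n) :
    X 0 ^ r * evalN (M + 1) (qq π) ∈ GJ M n := by
  set f := qq (π + Finsupp.single 1 1) with hf
  have hwt : wt (π + Finsupp.single 1 1) = n - (r - 1) := by
    rw [wt_add, wt_single, PNat.one_coe]; omega
  have hfL : f ∈ Lam (n - (r - 1)) := by rw [← hwt]; exact qq_mem_Lam _
  have hdeg : (π + Finsupp.single 1 1).degree = π.degree + 1 := by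
    rw [map_add, Finsupp.degree_single]
  have hG : X 0 ^ (r - 1) * evalN (M + 1) f ∈ GJ M n :=
    H1 _ _ (by rw [hdeg]; omega) (by omega) (by rw [hwt]; omega)
  have key := Zop_formula' (N := M + 1) (n := n) 0 (m := r - 1) (by omega) (by omega) hfL
  have hrm : r ∈ Finset.Icc 1 n := Finset.mem_Icc.2 ⟨by omega, by omega⟩
  rw [← Finset.add_sum_erase _ _ hrm] at key
  have hz : zco (M + 1) (r - 1) r f = qq π := by
    rw [zco, if_pos (by omega), show r - (r - 1) = 1 by omega, perpN]
    exact perp_qq 1 π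
  rw [hz] at key
  have h1 : ∑ x ∈ (Finset.Icc 1 n).erase r, X 0 ^ x * evalN (M + 1) (zco (M + 1) (r - 1) x f) ∈ GJ M n := by
    refine AddSubgroup.sum_mem _ fun b hb => ?_
    rw [Finset.mem_erase, Finset.mem_Icc] at hb
    obtain ⟨hbr, hb1, hbn⟩ := hb
    unfold zco
    split_ifs with h
    · -- a derivative of larger index
      have hs : b - (r - 1) ≠ 0 := by omega
      have hs1 : (b - (r - 1)).toPNat' ≠ 1 := by
        intro h0
        have := congrArg PNat.val h0
        rw [PNat.val_ofNat] at this
        have h3 := coe_toPNat' hs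
        omega
      rw [perpN]
      set s := (b - (r - 1)).toPNat' with hsd
      have hsv : (s : ℕ) = b - (r - 1) := coe_toPNat' hs
      by_cases h0 : π s = 0
      · have : perp s f = 0 := by
          apply perp_qq_zero
          rw [Finsupp.add_apply, h0, zero_add, Finsupp.single_eq_of_ne hs1]
        rw [this, map_zero, mul_zero]
        exact AddSubgroup.zero_mem _
      · obtain ⟨π0, hπ0⟩ : ∃ π0 : Exp, π = π0 + Finsupp.single s 1 := by
          refine ⟨π - Finsupp.single s 1, ?_⟩
          rw [tsub_add_cancel_of_le]
          rw [Finsupp.single_le_iff]; omega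
        have : perp s f = qq (π0 + Finsupp.single 1 1) := by
          rw [hf, hπ0, add_right_comm, perp_qq]
        rw [this]
        refine H2 _ _ ?_ (by omega) ?_
        · rw [hπ0, map_add, map_add, Finsupp.degree_single, Finsupp.degree_single]
        · rw [hπ0, wt_add, wt_single] at hw
          rw [wt_add, wt_single, PNat.one_coe]; omega
    · unfold pN
      split_ifs with h0
      · rw [← smul_eq_C_mul, map_smul, mul_smul_comm]
        refine smul_GJ (natCast_mem _ _) (H1 _ _ (by rw [hdeg]; omega) hb1 ?_)
        rw [hwt]; omega
      · rw [hf, X_mul_qq, map_smul, mul_smul_comm]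
        refine smul_GJ ?_ (H1 _ _ ?_ hb1 ?_)
        · refine ZA.mul_mem (ZA.mul_mem alpha_mem_ZA (natCast_mem _ _)) ?_
          exact ZA.add_mem (natCast_mem _ _) ZA.one_mem
        · rw [map_add, hdeg]; omega
        · rw [wt_add, hwt, wt_single, coe_toPNat' h0]; omega
  have h2 : X 0 ^ r * evalN (M + 1) (qq π) = Zop alpha 0 (X 0 ^ (r - 1) * evalN (M + 1) f)
      - ((alpha - 1) * ((r - 1 : ℕ) : F)) • (X 0 ^ (r - 1) * evalN (M + 1) f)
      - ∑ x ∈ (Finset.Icc 1 n).erase r, X 0 ^ x * evalN (M + 1) (zco (M + 1) (r - 1) x f) := by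
    rw [key]; ring
  rw [h2]
  refine AddSubgroup.sub_mem _ (AddSubgroup.sub_mem _ (Zop_GJ hG) (smul_GJ ?_ hG)) h1
  exact ZA.mul_mem (ZA.sub_mem alpha_mem_ZA ZA.one_mem) (natCast_mem _ _)

theorem qq_mem_GJ {M n : ℕ} (d e : ℕ) : ∀ (π : Exp) (r : ℕ), n - π.degree = d → n - r = e → 1 ≤ r →
    r + wt π = n → X 0 ^ r * evalN (M + 1) (qq π) ∈ GJ M n := by
  induction d using Nat.strong_induction_on generalizing e with
  | _ d ihd =>
    induction e using Nat.strong_induction_on with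
    | _ e ihe =>
      intro π r hd he hr hw
      rcases Nat.lt_or_ge 1 r with h | h
      · refine GJ_step π r h hw ?_ ?_
        · intro π' r' h1 h2 h3
          have := degree_le_wt π'
          exact ihd (n - π'.degree) (by omega) (n - r') π' r' rfl rfl h2 h3
        · intro π' r' h1 h2 h3
          exact ihe (n - r') (by omega) π' r' (by omega) rfl (by omega) h3
      · have : r = 1 := by omega
        subst this
        refine AddSubgroup.subset_closure ⟨0, qq π, qq_mem_Lq _, ?_, by simp⟩
        have := qq_mem_Lam π
        rwa [show n - 1 = wt π by omega]

theorem MM_le_GJ {M n : ℕ} : MM M n ≤ GJ M n := by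
  intro x hx
  rw [mem_MM] at hx
  obtain ⟨v, h1, h2, rfl⟩ := hx
  refine AddSubgroup.sum_mem _ fun b hb => ?_
  rw [Lam_sum_qq (h1 b hb), map_sum, Finset.mul_sum]
  refine AddSubgroup.sum_mem _ fun l _ => ?_
  rw [map_smul, mul_smul_comm]
  refine smul_GJ (mem_Lq.1 (h2 b hb) _) ?_
  obtain ⟨hb1, hb2⟩ := Finset.mem_Icc.1 hb
  refine qq_mem_GJ _ _ _ _ rfl rfl hb1 ?_
  rw [wt_toExp, l.2]; omega

theorem Zop_mem_MM {M n : ℕ} {f : SymA} (hf : f ∈ Lam n) (hq : f ∈ Lq) :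
    Zop alpha 0 (evalN (M + 1) f) ∈ MM M n := by
  rw [Zop_evalN' 0 hf, mem_MM]
  exact ⟨_, inV_Tf hf, fun b _ => perp_mem_Lq _ hq, rfl⟩

theorem mem_Lq_of_Zop {M n : ℕ} (hn : n ≤ M + 1) (h0 : n ≠ 0) {f : SymA} (hf : f ∈ Lam n)
    (h : Zop alpha 0 (evalN (M + 1) f) ∈ MM M n) : f ∈ Lq := by
  rw [Zop_evalN' 0 hf, mem_MM] at h
  obtain ⟨v, h1, h2, h3⟩ := h
  have h4 : inV n (fun b => Tf f b - v b) := fun b hb =>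
    Submodule.sub_mem _ (inV_Tf hf b hb) (h1 b hb)
  have h5 := EV_eq_zero hn h4 (by
    unfold EV at h3 ⊢
    simp only [map_sub, mul_sub, Finset.sum_sub_distrib]
    rw [h3, sub_self])
  refine mem_Lq_of_perpN h0 hf fun b hb => ?_
  have h6 : perpN b f = v b := sub_eq_zero.1 (h5 b hb)
  rw [h6]; exact h2 b hb

def q1 (n : ℕ) : SymA := qq (Finsupp.single 1 n)

theorem q1_mem_Lq (n : ℕ) : q1 n ∈ Lq := qq_mem_Lq _
theorem q1_mem_Lam (n : ℕ) : q1 n ∈ Lam n := by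
  have := qq_mem_Lam (Finsupp.single 1 n)
  rwa [wt_single, PNat.one_coe, mul_one] at this

theorem Zop_q1 (M n : ℕ) : Zop alpha 0 (evalN (M + 1) (q1 (n + 1))) = X 0 * evalN (M + 1) (q1 n) := by
  rw [Zop_evalN' 0 (q1_mem_Lam _), EV, Finset.sum_eq_single 1]
  · rw [pow_one, Tf, perpN, q1, Finsupp.single_add]
    have := perp_qq 1 (Finsupp.single 1 n)
    rw [show Nat.toPNat' 1 = 1 from rfl, this, q1]
  · intro b hb hb1
    obtain ⟨h1, h2⟩ := Finset.mem_Icc.1 hb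
    have : perpN b (q1 (n + 1)) = 0 := by
      apply perp_qq_zero
      rw [Finsupp.single_eq_of_ne]
      intro h
      have h3 := coe_toPNat' (k := b) (by omega)
      rw [h, PNat.one_coe] at h3
      exact hb1 h3.symm
    rw [Tf, this, map_zero, mul_zero]
  · intro h; exact absurd (Finset.mem_Icc.2 ⟨le_rfl, by omega⟩) h

section
variable {J : JPartition → SymA}

theorem hall_qq (m : Exp) (f : SymA) : hall (qq m) f = coeff m f := by
  rw [qq, hall_monomial_left, tc, mul_comm, mul_assoc, mul_inv_cancel₀ (zalpha_ne_zero _), mul_one]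

theorem qq_expand (hJ : IsJackFamily J) {n : ℕ} {m : Exp} (hm : wt m = n) :
    qq m = ∑ l : Pt n, (coeff m (J l.1) / hall (J l.1) (J l.1)) • J l.1 := by
  have h0 := qq_mem_Lam m
  rw [hm] at h0
  obtain ⟨c, hc⟩ := J_expand hJ h0
  rw [hc]
  refine Finset.sum_congr rfl fun l _ => ?_
  have h1 := hall_sum_J hJ c l
  rw [← hc, hall_qq] at h1
  rw [h1, mul_div_cancel_right₀ _ (J_norm hJ _)]

theorem q1_expand (hJ : IsJackFamily J) (n : ℕ) :
    q1 n = ∑ l : Pt n, (1 / hall (J l.1) (J l.1)) • J l.1 := by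
  rw [q1, qq_expand hJ (n := n) (by rw [wt_single, PNat.one_coe, mul_one])]
  refine Finset.sum_congr rfl fun l _ => ?_
  have := hJ.normalized l.1
  rw [l.2] at this
  rw [this]

theorem apply_q1 {M n : ℕ} {b : Module.End F (MvPolynomial (Fin (M + 1)) F)}
    {φ : Pt n → F} (hb : ∀ l : Pt n, b (evalN (M+1) (J l.1)) = φ l • evalN (M+1) (J l.1))
    (c : Pt n → F) :
    b (evalN (M + 1) (∑ l, c l • J l.1)) = evalN (M + 1) (∑ l, (φ l * c l) • J l.1) := by
  rw [map_sum, map_sum, map_sum]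
  refine Finset.sum_congr rfl fun l _ => ?_
  rw [map_smul, map_smul, hb, map_smul, smul_smul, mul_comm]

/-- every element is obtained from `q1` by an operator -/
theorem exists_op (hJ : IsJackFamily J) {M n : ℕ} (hn : n ≤ M + 1) {g : SymA} (hg : g ∈ Lam n) :
    ∃ b ∈ ZZ alpha (M + 1), b (evalN (M + 1) (q1 n)) = evalN (M + 1) g := by
  obtain ⟨c, rfl⟩ := J_expand hJ hg
  obtain ⟨b, hb, h⟩ := ZZ_realize hJ hn (fun l => c l * hall (J l.1) (J l.1))
  refine ⟨b, hb, ?_⟩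
  rw [q1_expand hJ, apply_q1 h]
  congr 1
  refine Finset.sum_congr rfl fun l _ => ?_
  rw [mul_one_div, mul_div_cancel_right₀ _ (J_norm hJ _)]

theorem ZZ_Lam (hJ : IsJackFamily J) {M n : ℕ} (hn : n ≤ M + 1)
    {b : Module.End F (MvPolynomial (Fin (M + 1)) F)} (hb : b ∈ ZZ alpha (M + 1)) {f : SymA} (hf : f ∈ Lam n) :
    ∃ h ∈ Lam n, b (evalN (M + 1) f) = evalN (M + 1) h := by
  obtain ⟨c, rfl⟩ := J_expand hJ hf
  choose e he using ZZ_eigen hJ hn b hb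
  exact ⟨_, sum_J_mem hJ _, apply_q1 he c⟩

/-- the integrality property -/
def CC (M n : ℕ) : Prop := ∀ b ∈ ZZ alpha (M + 1),
  (∃ h ∈ Lq, h ∈ Lam n ∧ b (evalN (M + 1) (q1 n)) = evalN (M + 1) h) →
  ∀ f ∈ Lq, f ∈ Lam n → ∃ h ∈ Lq, h ∈ Lam n ∧ b (evalN (M + 1) f) = evalN (M + 1) h

theorem CC_zero (M : ℕ) : CC M 0 := by
  rintro b hb ⟨h, h1, h2, h3⟩ f hf hf0
  have : f = tc 0 f • q1 0 := by
    apply eq_of_tc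
    intro m
    rw [tc_smul, q1, Finsupp.single_zero, tc_qq]
    split_ifs with h
    · rw [← h, mul_one]
    · rw [mul_zero, tc, hf0 m (fun h0 => h (wt_eq_zero h0).symm), zero_mul]
  rw [this]
  refine ⟨tc 0 f • h, smul_mem_Lq (mem_Lq.1 hf 0) h1, Submodule.smul_mem _ _ h2, ?_⟩
  rw [map_smul, map_smul, map_smul, h3]

theorem CC_succ (hJ : IsJackFamily J) {M n : ℕ} (hn : n + 1 ≤ M + 1) (ih : CC M n) : CC M (n + 1) := by
  rintro b hb ⟨h, h1, h2, h3⟩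
  have hbZ := Zop_comm_ZZ alpha (0 : Fin (M + 1)) b hb
  -- `b` preserves `MM`
  have hMM : ∀ x ∈ GJ M (n + 1), b x ∈ MM M (n + 1) := by
    intro x hx
    induction hx using AddSubgroup.closure_induction with
    | mem x hx =>
      obtain ⟨k, g, hg1, hg2, rfl⟩ := hx
      rw [Nat.add_sub_cancel] at hg2
      obtain ⟨a, ha, hag⟩ := exists_op hJ (M := M) (by omega) hg2
      obtain ⟨a', ha1, ha2, ha3⟩ := ZZ_check alpha a ha
      have e1 : X 0 * evalN (M + 1) g = a' (Zop alpha 0 (evalN (M + 1) (q1 (n + 1)))) := by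
        rw [Zop_q1, ← hag]
        have := DFunLike.congr_fun ha1 (evalN (M + 1) (q1 n))
        rw [Module.End.mul_apply, Module.End.mul_apply, xm_apply, xm_apply] at this
        exact this.symm
      have e2 : b ((Zop alpha 0 ^ k) (X 0 * evalN (M + 1) g)) =
          (Zop alpha 0 ^ k) (a' (Zop alpha 0 (b (evalN (M + 1) (q1 (n + 1)))))) := by
        rw [e1]
        have c1 : Commute b (Zop alpha 0) := hbZ.symm
        have c2 : Commute b a' := (ha3 b hb).symm
        have c3 : Commute b (Zop alpha 0 ^ k * (a' * Zop alpha 0)) :=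
          (c1.pow_right k).mul_right (c2.mul_right c1)
        have c4 := DFunLike.congr_fun c3.eq (evalN (M + 1) (q1 (n + 1)))
        simp only [Module.End.mul_apply] at c4
        exact c4
      rw [e2]
      apply Zop_pow_MM
      apply GJ_le_MM (by omega)
      rw [h3]
      have e3 := MM_le_GJ (Zop_mem_MM (M := M) h2 h1)
      -- `a'` preserves `GJ`
      revert e3
      generalize Zop alpha 0 (evalN (M + 1) h) = y
      intro hy
      induction hy using AddSubgroup.closure_induction with
      | mem y hy =>
        obtain ⟨j, g', hg1', hg2', rfl⟩ := hy
        rw [Nat.add_sub_cancel] at hg2'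
        obtain ⟨u, hu1, hu2, hu3⟩ := ih a ha ⟨g, hg1, hg2, hag⟩ g' hg1' hg2'
        refine AddSubgroup.subset_closure ⟨j, u, hu1, hu2, ?_⟩
        have c1 : Commute a' (Zop alpha 0 ^ j) := Commute.pow_right ha2 j
        rw [← Module.End.mul_apply, c1.eq, Module.End.mul_apply]
        congr 1
        have := DFunLike.congr_fun ha1 (evalN (M + 1) g')
        rw [Module.End.mul_apply, Module.End.mul_apply, xm_apply, xm_apply, hu3] at this
        exact this
      | zero => rw [map_zero]; exact AddSubgroup.zero_mem _
      | add x y _ _ h1 h2 => rw [map_add]; exact AddSubgroup.add_mem _ h1 h2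
      | neg x _ h => rw [map_neg]; exact AddSubgroup.neg_mem _ h
    | zero => rw [map_zero]; exact AddSubgroup.zero_mem _
    | add x y _ _ h1 h2 => rw [map_add]; exact AddSubgroup.add_mem _ h1 h2
    | neg x _ h => rw [map_neg]; exact AddSubgroup.neg_mem _ h
  intro f hf1 hf2
  obtain ⟨u, hu, hbu⟩ := ZZ_Lam hJ hn hb hf2
  refine ⟨u, ?_, hu, hbu⟩
  apply mem_Lq_of_Zop hn (by omega) hu
  rw [← hbu, ← Module.End.mul_apply, hbZ, Module.End.mul_apply]
  exact hMM _ (MM_le_GJ (Zop_mem_MM hf2 hf1))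

theorem CC_all (hJ : IsJackFamily J) (M n : ℕ) (hn : n ≤ M + 1) : CC M n := by
  induction n with
  | zero => exact CC_zero M
  | succ n ih => exact CC_succ hJ hn (ih (by omega))

/-- The integrality of the connection coefficients of Jack polynomials. -/
theorem core (hJ : IsJackFamily J) {n : ℕ} (mu nu : Pt n) : ∃ c : Pt n → F, (∀ p, c p ∈ ZA) ∧
    ∀ l : Pt n, coeff (toExp mu.1) (J l.1) * coeff (toExp nu.1) (J l.1) =
      ∑ p : Pt n, c p * coeff (toExp p.1) (J l.1) := by
  have hw : ∀ m : Pt n, wt (toExp m.1) = n := fun m => by rw [wt_toExp, m.2]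
  have hL : ∀ m : Pt n, qq (toExp m.1) ∈ Lam n := fun m => by
    have := qq_mem_Lam (toExp m.1)
    rwa [hw m] at this
  have hn : n ≤ n + 1 := by omega
  obtain ⟨b, hb, hbe⟩ := ZZ_realize hJ hn (fun l => coeff (toExp mu.1) (J l.1))
  have h1 : b (evalN (n + 1) (q1 n)) = evalN (n + 1) (qq (toExp mu.1)) := by
    rw [q1_expand hJ, apply_q1 hbe, qq_expand hJ (hw mu)]
    simp only [mul_one_div]
  obtain ⟨h, hh1, hh2, hh3⟩ := CC_all hJ n n hn b hb ⟨_, qq_mem_Lq _, hL mu, h1⟩ _ (qq_mem_Lq (toExp nu.1)) (hL nu)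
  refine ⟨fun p => tc (toExp p.1) h, fun p => mem_Lq.1 hh1 _, fun l => ?_⟩
  rw [qq_expand hJ (hw nu), apply_q1 hbe] at hh3
  have h4 := evalN_inj hn (sum_J_mem hJ _) hh2 hh3
  have h5 := congrArg (fun x => hall x (J l.1)) h4
  rw [hall_sum_J hJ, Lam_sum_qq hh2, hall_sum_left] at h5
  simp only [hall_smul_left, hall_qq] at h5
  rw [← h5, mul_assoc, div_mul_cancel₀ _ (J_norm hJ _)]
end

/-! ### Reduction of the structure coefficients -/

theorem psize_addOnes (l : JPartition) (k : ℕ) : psize (addOnes l k) = psize l + k := by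
  simp [psize_eq, addOnes]

theorem addOnes_zero (l : JPartition) : addOnes l 0 = l := by
  simp [addOnes]

/-- transition weights from characters to power-sum coefficients in degree `n` -/
def wgt (n : ℕ) (r p : JPartition) : F :=
  if psize r ≤ n ∧ addOnes r (n - psize r) = p then
    (Nat.choose (n - psize r + pmult r 1) (pmult r 1) : F) else 0

theorem wgt_mem (n : ℕ) (r p : JPartition) : wgt n r p ∈ ZA := by
  unfold wgt
  split_ifs
  · exact natCast_mem _ _
  · exact ZA.zero_mem

theorem theta_eq (J : JPartition → SymA) {n : ℕ} (r : JPartition) (l : Pt n) :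
    theta J r l.1 = ∑ p : Pt n, wgt n r p.1 * coeff (toExp p.1) (J l.1) := by
  unfold theta wgt
  rw [l.2]
  split_ifs with h
  · symm
    refine Finset.sum_eq_zero fun p _ => ?_
    rw [if_neg (fun h' => by omega), zero_mul]
  · have hp : psize (addOnes r (n - psize r)) = n := by rw [psize_addOnes]; omega
    rw [Finset.sum_eq_single ⟨_, hp⟩]
    · rw [if_pos ⟨by omega, rfl⟩]
    · intro p _ hne
      rw [if_neg, zero_mul]
      rintro ⟨_, h2⟩
      exact hne (Subtype.ext h2.symm)
    · simp

theorem core' {J : JPartition → SymA} (hJ : IsJackFamily J) (n : ℕ) (mu nu : JPartition) :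
    ∃ d : Pt n → F, (∀ p, d p ∈ ZA) ∧ ∀ l : Pt n, theta J mu l.1 * theta J nu l.1 =
      ∑ p : Pt n, d p * coeff (toExp p.1) (J l.1) := by
  choose c hc1 hc2 using fun (m k : Pt n) => core hJ m k
  refine ⟨fun p => ∑ m : Pt n, ∑ k : Pt n, wgt n mu m.1 * wgt n nu k.1 * c m k p, fun p => ?_, fun l => ?_⟩
  · exact ZA.sum_mem fun m _ => ZA.sum_mem fun k _ =>
      ZA.mul_mem (ZA.mul_mem (wgt_mem _ _ _) (wgt_mem _ _ _)) (hc1 m k p)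
  · rw [theta_eq, theta_eq, Finset.sum_mul_sum]
    simp only [Finset.sum_mul]
    rw [Finset.sum_comm]
    conv_rhs => rw [Finset.sum_comm]
    rw [Finset.sum_comm]
    refine Finset.sum_congr rfl fun m _ => ?_
    rw [Finset.sum_comm]
    refine Finset.sum_congr rfl fun k _ => ?_
    rw [mul_mul_mul_comm, hc2, Finset.mul_sum]
    refine Finset.sum_congr rfl fun p _ => ?_
    ring

theorem g_mem {J : JPartition → SymA} (hJ : IsJackFamily J)
    {g : JPartition → JPartition → JPartition → F} (hg : IsStructCoeffs J g) (mu nu : JPartition) (n : ℕ) :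
    ∀ p : JPartition, psize p = n → g p mu nu ∈ ZA := by
  induction n using Nat.strong_induction_on with
  | _ n ih =>
    intro p hp
    obtain ⟨d, hd1, hd2⟩ := core' hJ n mu nu
    set S := (hg.1 mu nu).toFinset with hS
    have h1 : ∀ l : Pt n, theta J mu l.1 * theta J nu l.1 =
        ∑ q : Pt n, (∑ r ∈ S, g r mu nu * wgt n r q.1) * coeff (toExp q.1) (J l.1) := by
      intro l
      rw [hg.2, finsum_eq_sum_of_support_subset (s := S)]
      · simp only [theta_eq, Finset.mul_sum, Finset.sum_mul]
        rw [Finset.sum_comm]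
        simp only [mul_assoc]
      · intro r hr
        rw [Function.mem_support] at hr
        rw [hS, Set.Finite.coe_toFinset]
        exact left_ne_zero_of_mul hr
    have h2 : d = fun q : Pt n => ∑ r ∈ S, g r mu nu * wgt n r q.1 := by
      apply Matrix.mulVec_injective_iff_isUnit.2 (Pm_unit hJ n)
      funext l
      have := (hd2 l).symm.trans (h1 l)
      simp only [Matrix.mulVec, dotProduct, Pm]
      simp only [mul_comm (coeff _ _)]
      exact this
    have h3 := congrFun h2 ⟨p, hp⟩
    have hw : wgt n p p = 1 := by
      rw [wgt, hp, Nat.sub_self, addOnes_zero, if_pos ⟨le_rfl, rfl⟩, zero_add, Nat.choose_self, Nat.cast_one]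
    by_cases hpS : p ∈ S
    · simp only at h3
      rw [← Finset.add_sum_erase _ _ hpS, hw, mul_one] at h3
      rw [← sub_eq_iff_eq_add] at h3
      rw [← h3]
      refine ZA.sub_mem (hd1 _) (ZA.sum_mem fun r hr => ?_)
      obtain ⟨hr1, hr2⟩ := Finset.mem_erase.1 hr
      rcases lt_or_ge (psize r) n with h | h
      · exact ZA.mul_mem (ih _ h r rfl) (wgt_mem _ _ _)
      · have : wgt n r p = 0 := by
          rw [wgt, if_neg]
          rintro ⟨h4, h5⟩
          rw [show n - psize r = 0 by omega, addOnes_zero] at h5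
          exact hr1 h5
        rw [this, mul_zero]
        exact ZA.zero_mem
    · have : g p mu nu = 0 := by
        by_contra h0
        exact hpS ((Set.Finite.mem_toFinset _).2 h0)
      rw [this]; exact ZA.zero_mem

/-- **Corollary 3.7.** The structure coefficients `g^π_{μ,ν}(α)` are polynomials in
`b = α - 1` with integer coefficients. -/
theorem statement7
    (J : JPartition → SymA) (hJ : IsJackFamily J)
    (g : JPartition → JPartition → JPartition → F) (hg : IsStructCoeffs J g)
    (pi mu nu : JPartition) :
    ∃ c : Polynomial ℤ,
      g pi mu nu = Polynomial.eval (alpha - 1) (c.map (Int.castRingHom F)) := by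
  obtain ⟨c, hc⟩ := g_mem hJ hg mu nu _ pi rfl
  refine ⟨c, ?_⟩
  rw [Polynomial.eval_map, ← hc]
  rfl

end
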